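/- arXiv:2602.01295 — 7 statements merged into one kernel-verified Lean document; each statement's English description precedes it below -/
import Mathlib

section
/- Pointwise uniform bound of the shifted loss: for every state-action pair (s,a), almost surely (i.e., for every realization of the trajectory and the losses), |ℓ̃^{shift}(s,a)| ≤ (1 + H·S·A·(1 + A^{1−1/α})) · C σ t^{1/α} · x(s,a)^{1/α − 1}. -/
open Finset MeasureTheory

open scoped Classical

/-- A probability times a negative power of a mass dominating it is at most that power of the
proportionality constant. -/
theorem mul_rpow_sub_one_le {p c y b : ℝ} (hp0 : 0 ≤ p) (hp1 : p ≤ 1) (hc : 0 < c)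
    (hpc : p * c ≤ y) (hb0 : 0 ≤ b) (hb1 : b ≤ 1) :
    p * y ^ (b - 1) ≤ c ^ (b - 1) := by
  rcases hp0.eq_or_lt with rfl | hp
  · rw [zero_mul]
    positivity
  · calc p * y ^ (b - 1) ≤ p * (p * c) ^ (b - 1) := by
          refine mul_le_mul_of_nonneg_left ?_ hp0
          exact Real.rpow_le_rpow_of_nonpos (mul_pos hp hc) hpc (by linarith)
      _ = p ^ b * c ^ (b - 1) := by
          rw [Real.mul_rpow hp.le hc.le, ← mul_assoc, Real.rpow_sub_one hp.ne']
          field_simp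
      _ ≤ 1 * c ^ (b - 1) := by
          gcongr
          exact Real.rpow_le_one hp.le hp1 hb0
      _ = c ^ (b - 1) := one_mul _

/-- If the state weights `w` have mass at most one, are dominated by the state occupancies `X`
up to the factor `c`, and live on layers with at most `n` layers to go, then the `w`-average of
the absolute values is at most `n` times the contribution of a single layer. -/
theorem sum_mul_abs_value_le {S A : Type*} [Fintype S] [Fintype A] {H : ℕ} {layer : S → ℕ}
    (hlayer : ∀ s, layer s ≤ H) {P : S → A → S → ℝ} (hP_nonneg : ∀ s a s', 0 ≤ P s a s')
    (hP_supp : ∀ s a s', P s a s' ≠ 0 → layer s' = layer s + 1)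
    (hP_sum : ∀ s a, ∑ s', P s a s' ≤ 1)
    {π : S → A → ℝ} (hπ_nonneg : ∀ s a, 0 ≤ π s a) (hπ_sum : ∀ s, ∑ a, π s a = 1)
    {x : S → A → ℝ} {X : S → ℝ} (hxX : ∀ s a, x s a = π s a * X s)
    (hX : ∀ s', ∑ s, ∑ a, P s a s' * x s a ≤ X s')
    {ℓ : S → A → ℝ} {V : S → ℝ} (hV : ∀ s, V s = ∑ a, π s a * (ℓ s a + ∑ s', P s a s' * V s'))
    {B b : ℝ} (hB : 0 ≤ B) (hb0 : 0 ≤ b) (hb1 : b ≤ 1)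
    (hℓ : ∀ s a, |ℓ s a| ≤ B * x s a ^ (b - 1)) {c : ℝ} (hc : 0 < c) (n : ℕ) (w : S → ℝ)
    (hw_nonneg : ∀ s, 0 ≤ w s) (hw_supp : ∀ s, w s ≠ 0 → H < layer s + n)
    (hw_sum : ∑ s, w s ≤ 1) (hwX : ∀ s, w s * c ≤ X s) :
    ∑ s, w s * |V s| ≤ n * (Fintype.card S * Fintype.card A * (B * c ^ (b - 1))) := by
  induction n generalizing w with
  | zero =>
    have h0 : ∀ s, w s = 0 := fun s => by
      by_contra h
      have := hw_supp s h
      have := hlayer s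
      omega
    simp [h0]
  | succ n ih =>
    have hπ_le : ∀ s a, π s a ≤ 1 := fun s a =>
      (hπ_sum s).symm ▸ Finset.single_le_sum (fun a _ => hπ_nonneg s a) (Finset.mem_univ a)
    have hw_le : ∀ s, w s ≤ 1 := fun s =>
      (Finset.single_le_sum (fun s _ => hw_nonneg s) (Finset.mem_univ s)).trans hw_sum
    set w' : S → ℝ := fun s' => ∑ s, ∑ a, w s * π s a * P s a s' with hw'
    have hnext : ∑ s', w' s' * |V s'| ≤
        n * (Fintype.card S * Fintype.card A * (B * c ^ (b - 1))) := by
      refine ih w' (fun s' => Finset.sum_nonneg fun s _ => Finset.sum_nonneg fun a _ =>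
        mul_nonneg (mul_nonneg (hw_nonneg s) (hπ_nonneg s a)) (hP_nonneg s a s')) ?_ ?_ ?_
      · intro s' hs'
        obtain ⟨s, -, hs⟩ := Finset.exists_ne_zero_of_sum_ne_zero hs'
        obtain ⟨a, -, ha⟩ := Finset.exists_ne_zero_of_sum_ne_zero hs
        have h1 := hw_supp s (left_ne_zero_of_mul (left_ne_zero_of_mul ha))
        have h2 := hP_supp s a s' (right_ne_zero_of_mul ha)
        omega
      · calc ∑ s', w' s' = ∑ s, ∑ a, w s * π s a * ∑ s', P s a s' := by
              simp only [hw', Finset.mul_sum]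
              rw [Finset.sum_comm]
              exact Finset.sum_congr rfl fun s _ => Finset.sum_comm
          _ ≤ ∑ s, ∑ a, w s * π s a := by
              refine Finset.sum_le_sum fun s _ => Finset.sum_le_sum fun a _ => ?_
              exact mul_le_of_le_one_right (mul_nonneg (hw_nonneg s) (hπ_nonneg s a))
                (hP_sum s a)
          _ = ∑ s, w s := by simp only [← Finset.mul_sum, hπ_sum, mul_one]
          _ ≤ 1 := hw_sum
      · intro s'
        refine le_trans ?_ (hX s')
        simp only [hw', Finset.sum_mul]
        refine Finset.sum_le_sum fun s _ => Finset.sum_le_sum fun a _ => ?_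
        rw [hxX]
        calc w s * π s a * P s a s' * c = P s a s' * (π s a * (w s * c)) := by ring
          _ ≤ P s a s' * (π s a * X s) :=
            mul_le_mul_of_nonneg_left (mul_le_mul_of_nonneg_left (hwX s) (hπ_nonneg s a))
              (hP_nonneg s a s')
    have hcur : ∑ s, ∑ a, w s * π s a * |ℓ s a| ≤
        Fintype.card S * Fintype.card A * (B * c ^ (b - 1)) := by
      calc ∑ s, ∑ a, w s * π s a * |ℓ s a| ≤ ∑ _s : S, ∑ _a : A, B * c ^ (b - 1) := by
            refine Finset.sum_le_sum fun s _ => Finset.sum_le_sum fun a _ => ?_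
            have hp := mul_nonneg (hw_nonneg s) (hπ_nonneg s a)
            have hpc : w s * π s a * c ≤ x s a := by
              rw [hxX]
              linarith [mul_le_mul_of_nonneg_left (hwX s) (hπ_nonneg s a)]
            calc w s * π s a * |ℓ s a| ≤ w s * π s a * (B * x s a ^ (b - 1)) :=
                  mul_le_mul_of_nonneg_left (hℓ s a) hp
              _ = B * (w s * π s a * x s a ^ (b - 1)) := by ring
              _ ≤ B * c ^ (b - 1) := mul_le_mul_of_nonneg_left
                  (mul_rpow_sub_one_le hp
                    (mul_le_one₀ (hw_le s) (hπ_nonneg s a) (hπ_le s a)) hc hpc hb0 hb1) hB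
        _ = Fintype.card S * Fintype.card A * (B * c ^ (b - 1)) := by
            simp [mul_assoc]
    calc ∑ s, w s * |V s|
        ≤ ∑ s, w s * ∑ a, π s a * (|ℓ s a| + ∑ s', P s a s' * |V s'|) := by
          gcongr with s _
          · exact hw_nonneg s
          rw [hV s]
          refine (Finset.abs_sum_le_sum_abs _ _).trans ?_
          gcongr with a _
          rw [abs_mul, abs_of_nonneg (hπ_nonneg s a)]
          refine mul_le_mul_of_nonneg_left ((abs_add_le _ _).trans ?_) (hπ_nonneg s a)
          gcongr
          refine (Finset.abs_sum_le_sum_abs _ _).trans_eq ?_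
          exact Finset.sum_congr rfl fun s' _ => by rw [abs_mul, abs_of_nonneg (hP_nonneg s a s')]
      _ = ∑ s, ∑ a, w s * π s a * |ℓ s a| + ∑ s', w' s' * |V s'| := by
          have hswap : ∑ s', w' s' * |V s'| =
              ∑ s, ∑ a, ∑ s', w s * π s a * P s a s' * |V s'| := by
            simp only [hw', Finset.sum_mul]
            rw [Finset.sum_comm]
            exact Finset.sum_congr rfl fun s _ => Finset.sum_comm
          rw [hswap]
          simp only [mul_add, Finset.mul_sum, Finset.sum_add_distrib, mul_assoc]
      _ ≤ _ := by
          push_cast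
          linarith

theorem stmt_0
    {S A : Type*} [Fintype S] [Fintype A] [Nonempty S] [Nonempty A]
    [DecidableEq S] [DecidableEq A]
    (H : ℕ) (hH : 1 ≤ H)
    (layer : S → ℕ)
    (hlayer : ∀ s : S, 1 ≤ layer s ∧ layer s ≤ H)
    (hlayer_ne : ∀ h : ℕ, 1 ≤ h → h ≤ H → ∃ s : S, layer s = h)
    (s1 : S) (hs1 : ∀ s : S, (layer s = 1 ↔ s = s1))
    (P : S → A → S → ℝ)
    (hP_nonneg : ∀ s a s', 0 ≤ P s a s')
    (hP_supp : ∀ s a s', P s a s' ≠ 0 → layer s' = layer s + 1)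
    (hP_sum : ∀ s a, layer s < H → ∑ s', P s a s' = 1)
    (π : S → A → ℝ)
    (hπ_nonneg : ∀ s a, 0 ≤ π s a)
    (hπ_sum : ∀ s, ∑ a, π s a = 1)
    (x : S → A → ℝ)
    (hx_init : ∀ a, x s1 a = π s1 a)
    (hx_rec : ∀ s' a', 2 ≤ layer s' → x s' a' = π s' a' * ∑ s, ∑ a, P s a s' * x s a)
    (hx_pos : ∀ s a, 0 < x s a)
    (Q : (S → A → ℝ) → S → A → ℝ) (V : (S → A → ℝ) → S → ℝ)
    (hQ : ∀ ℓ s a, Q ℓ s a = ℓ s a + ∑ s', P s a s' * V ℓ s')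
    (hV : ∀ ℓ s, V ℓ s = ∑ a, π s a * Q ℓ s a)
    (α σ C t : ℝ)
    (hα1 : 1 < α) (hα2 : α ≤ 2) (hσ : 0 < σ) (hC : 0 < C) (ht : 1 ≤ t)
    (traj : Fin H → S × A)
    (htraj_layer : ∀ h : Fin H, layer (traj h).1 = (h : ℕ) + 1)
    (htraj_pi : ∀ h : Fin H, 0 < π (traj h).1 (traj h).2)
    (htraj_P : ∀ (h : Fin H) (hh : (h : ℕ) + 1 < H),
      0 < P (traj h).1 (traj h).2 (traj ⟨(h : ℕ) + 1, hh⟩).1)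
    (ℓ : S → A → ℝ)
    (ℓskip : S → A → ℝ)
    (hℓskip : ∀ s a, ℓskip s a =
      (if ∃ h : Fin H, traj h = (s, a) then
        (if |ℓ s a| ≤ C * σ * t ^ (1/α) * x s a ^ (1/α) then ℓ s a else 0) / x s a
      else 0))
    :
    ∀ s a, |Q ℓskip s a - V ℓskip s| ≤
      (1 + (H : ℝ) * (Fintype.card S : ℝ) * (Fintype.card A : ℝ) *
        (1 + (Fintype.card A : ℝ) ^ (1 - 1/α))) * C * σ * t ^ (1/α) * x s a ^ (1/α - 1) := by
  intro s a
  set X : S → ℝ := fun s => ∑ a, x s a with hXdef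
  set b : ℝ := 1 / α with hb
  set B : ℝ := C * σ * t ^ b with hBdef
  have hα : 0 < α := by linarith
  have hb0 : 0 ≤ b := by positivity
  have hb1 : b ≤ 1 := by
    rw [hb, div_le_one hα]
    exact hα1.le
  have ht0 : 0 < t := by linarith
  have hB : 0 ≤ B := by positivity
  have hflow : ∀ s', 2 ≤ layer s' → X s' = ∑ s, ∑ a, P s a s' * x s a := by
    intro s' hs'
    simp only [hXdef, hx_rec s' _ hs', ← Finset.sum_mul, hπ_sum, one_mul]
  have hxX : ∀ s a, x s a = π s a * X s := by
    intro s a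
    rcases eq_or_ne s s1 with rfl | hs
    · simp only [hXdef, hx_init, hπ_sum, mul_one]
    · have h2 : 2 ≤ layer s := by
        have := (hlayer s).1
        have := mt (hs1 s).1 hs
        omega
      rw [hflow s h2, hx_rec s a h2]
  have hX_nonneg : ∀ s, 0 ≤ X s := fun s => Finset.sum_nonneg fun a _ => (hx_pos s a).le
  have hX : ∀ s', ∑ s, ∑ a, P s a s' * x s a ≤ X s' := by
    intro s'
    by_cases h2 : 2 ≤ layer s'
    · exact (hflow s' h2).ge
    · have h0 : ∀ s a, P s a s' = 0 := fun s a => by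
        by_contra h
        have := hP_supp s a s' h
        have := (hlayer s).1
        omega
      simpa [h0] using hX_nonneg s'
  have hP_le : ∀ s a, ∑ s', P s a s' ≤ 1 := by
    intro s a
    by_cases hs : layer s < H
    · exact (hP_sum s a hs).le
    · have h0 : ∀ s', P s a s' = 0 := fun s' => by
        by_contra h
        have := hP_supp s a s' h
        have := (hlayer s').2
        omega
      simp [h0]
  have hℓ : ∀ s a, |ℓskip s a| ≤ B * x s a ^ (b - 1) := by
    intro s a
    have hxp := hx_pos s a
    rw [hℓskip]
    split_ifs with h1 h2
    · rw [abs_div, abs_of_pos hxp, Real.rpow_sub_one hxp.ne', ← mul_div_assoc]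
      gcongr
    · rw [zero_div, abs_zero]
      positivity
    · rw [abs_zero]
      positivity
  have hVrec : ∀ s, V ℓskip s = ∑ a, π s a * (ℓskip s a + ∑ s', P s a s' * V ℓskip s') := by
    intro s
    rw [hV]
    simp only [hQ]
  have key := sum_mul_abs_value_le (fun s => (hlayer s).2) hP_nonneg hP_supp hP_le hπ_nonneg
    hπ_sum hxX hX hVrec hB hb0 hb1 hℓ (hx_pos s a)
  set D : ℝ := B * x s a ^ (b - 1) with hD
  set K : ℝ := Fintype.card S * Fintype.card A with hK
  have hD0 : 0 ≤ D := mul_nonneg hB (Real.rpow_nonneg (hx_pos s a).le _)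
  have hVs : |V ℓskip s| ≤ H * (K * D) := by
    have h := key H (Pi.single s 1) (fun s' => by by_cases h : s' = s <;> simp [h])
      (fun s' _ => by have := (hlayer s').1; omega) (by simp) ?_
    · simpa [Pi.single_apply] using h
    · intro s'
      rcases eq_or_ne s' s with rfl | h
      · simpa [hXdef] using
          Finset.single_le_sum (fun a _ => (hx_pos s' a).le) (Finset.mem_univ a)
      · simpa [h] using hX_nonneg s'
  have hnext : |∑ s', P s a s' * V ℓskip s'| ≤ H * (K * D) := by
    calc |∑ s', P s a s' * V ℓskip s'| ≤ ∑ s', P s a s' * |V ℓskip s'| := by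
          refine (Finset.abs_sum_le_sum_abs _ _).trans_eq ?_
          exact Finset.sum_congr rfl fun s' _ => by rw [abs_mul, abs_of_nonneg (hP_nonneg s a s')]
      _ ≤ H * (K * D) := by
          refine key H (P s a) (hP_nonneg s a)
            (fun s' _ => by have := (hlayer s').1; omega) (hP_le s a) fun s' => ?_
          refine le_trans ?_ (hX s')
          have hnn : ∀ s a, 0 ≤ P s a s' * x s a := fun s a =>
            mul_nonneg (hP_nonneg s a s') (hx_pos s a).le
          exact (Finset.single_le_sum (fun a _ => hnn s a) (Finset.mem_univ a)).trans
            (Finset.single_le_sum (f := fun s => ∑ a, P s a s' * x s a)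
              (fun s _ => Finset.sum_nonneg fun a _ => hnn s a) (Finset.mem_univ s))
  have hA : (1 : ℝ) ≤ (Fintype.card A : ℝ) ^ (1 - b) :=
    Real.one_le_rpow (by exact_mod_cast Fintype.card_pos) (by linarith)
  have hHKD : 0 ≤ H * (K * D) := by positivity
  calc |Q ℓskip s a - V ℓskip s|
      ≤ |ℓskip s a| + |∑ s', P s a s' * V ℓskip s'| + |V ℓskip s| := by
        rw [hQ]
        exact (abs_sub _ _).trans (by gcongr; exact abs_add_le _ _)
    _ ≤ D + H * (K * D) * (1 + (Fintype.card A : ℝ) ^ (1 - b)) := by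
        linarith [hℓ s a, mul_le_mul_of_nonneg_left hA hHKD]
    _ = _ := by
        rw [hD, hBdef, hK]
        ring
end

section
/- Bound on the differential value-function term: for every state s ∈ 𝒮_h and action a, almost surely, the quantity ΔV(s,a) := ∑_{s'∈𝒮_{h+1}} ℙ[s'|s,a] V^{ℙ,π}(s'; ℓ̃^{skip}) − ∑_{a'∈𝒜} π(a'|s) ∑_{s'∈𝒮_{h+1}} ℙ[s'|s,a'] V^{ℙ,π}(s'; ℓ̃^{skip}) satisfies |ΔV(s,a)| ≤ H·S·A·(1 + A^{1−1/α}) · C σ t^{1/α} · x(s,a)^{1/α − 1}. -/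
open Finset MeasureTheory

open scoped Classical

/-- A layered transition kernel `P`, a policy `π` and the strictly positive occupancy measure `x`
which they generate. -/
structure IsLayeredOccupancy {S A : Type*} [Fintype S] [Fintype A] (H : ℕ) (layer : S → ℕ)
    (P : S → A → S → ℝ) (π x : S → A → ℝ) : Prop where
  layer_pos : ∀ s, 1 ≤ layer s
  layer_le : ∀ s, layer s ≤ H
  kernel_nonneg : ∀ s a s', 0 ≤ P s a s'
  kernel_supp : ∀ s a s', P s a s' ≠ 0 → layer s' = layer s + 1
  kernel_sum_le : ∀ s a, ∑ s', P s a s' ≤ 1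
  policy_nonneg : ∀ s a, 0 ≤ π s a
  policy_sum : ∀ s, ∑ a, π s a = 1
  pos : ∀ s a, 0 < x s a
  eq_policy_mul : ∀ s a, x s a = π s a * ∑ b, x s b
  flow : ∀ s', 2 ≤ layer s' → ∑ a, x s' a = ∑ s, ∑ a, P s a s' * x s a

/-- `V` and `Q` satisfy the Bellman equations for every loss. -/
structure IsValueFunction {S A : Type*} [Fintype S] [Fintype A] (P : S → A → S → ℝ)
    (π : S → A → ℝ) (Q : (S → A → ℝ) → S → A → ℝ) (V : (S → A → ℝ) → S → ℝ) : Prop where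
  action_value : ∀ ℓ s a, Q ℓ s a = ℓ s a + ∑ s', P s a s' * V ℓ s'
  state_value : ∀ ℓ s, V ℓ s = ∑ a, π s a * Q ℓ s a

/-- The loss charging one unit at the pair `(z, b)`. -/
def unitLoss {S A : Type*} [DecidableEq S] [DecidableEq A] (z : S) (b : A) (s : S) (a : A) : ℝ :=
  if s = z ∧ a = b then 1 else 0

lemma unitLoss_nonneg {S A : Type*} [DecidableEq S] [DecidableEq A] (z : S) (b : A) (s : S)
    (a : A) : 0 ≤ unitLoss z b s a := by
  unfold unitLoss
  split_ifs <;> norm_num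

lemma sum_mul_unitLoss {S A : Type*} [Fintype S] [Fintype A] [DecidableEq S] [DecidableEq A]
    (f : S → A → ℝ) (s : S) (a : A) : ∑ z, ∑ b, f z b * unitLoss z b s a = f s a := by
  rw [Finset.sum_eq_single s, Finset.sum_eq_single a]
  · simp [unitLoss]
  · intro b _ hb
    simp [unitLoss, hb.symm]
  · simp
  · intro z _ hz
    simp [unitLoss, hz.symm]
  · simp

lemma rpow_sub_one_mul_le {u v q r : ℝ} (hu : 0 < u) (hq : 0 ≤ q) (hq1 : q ≤ 1)
    (huq : u * q ≤ v) (hr : 0 < r) (hr1 : r ≤ 1) : v ^ (r - 1) * q ≤ u ^ (r - 1) := by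
  rcases hq.eq_or_lt with rfl | hq
  · simpa using Real.rpow_nonneg hu.le (r - 1)
  calc v ^ (r - 1) * q ≤ (u * q) ^ (r - 1) * q :=
        mul_le_mul_of_nonneg_right
          (Real.rpow_le_rpow_of_nonpos (mul_pos hu hq) huq (by linarith)) hq.le
    _ = u ^ (r - 1) * q ^ r := by
        rw [Real.mul_rpow hu.le hq.le, mul_assoc, Real.rpow_sub_one hq.ne' r,
          div_mul_cancel₀ _ hq.ne']
    _ ≤ u ^ (r - 1) :=
        mul_le_of_le_one_right (Real.rpow_nonneg hu.le _) (Real.rpow_le_one hq.le hq1 hr.le)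

lemma sum_rpow_inv_le {ι : Type*} [Fintype ι] {f : ι → ℝ} (hf : ∀ i, 0 ≤ f i) {p : ℝ}
    (hp : 1 ≤ p) :
    ∑ i, f i ^ (1 / p) ≤ (Fintype.card ι : ℝ) ^ (1 - 1 / p) * (∑ i, f i) ^ (1 / p) := by
  have hp0 : p ≠ 0 := by positivity
  have hg : ∀ i, 0 ≤ f i ^ (1 / p) := fun i => Real.rpow_nonneg (hf i) _
  have h := Real.rpow_sum_le_const_mul_sum_rpow_of_nonneg Finset.univ hp (fun i _ => hg i)
  simp only [← Real.rpow_mul (hf _), one_div_mul_cancel hp0, Real.rpow_one,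
    Finset.card_univ] at h
  have h2 := Real.rpow_le_rpow (Real.rpow_nonneg (Finset.sum_nonneg fun i _ => hg i) _) h
    (by positivity : 0 ≤ 1 / p)
  rwa [← Real.rpow_mul (Finset.sum_nonneg fun i _ => hg i), mul_one_div_cancel hp0, Real.rpow_one,
    Real.mul_rpow (by positivity) (Finset.sum_nonneg fun i _ => hf i),
    ← Real.rpow_mul (by positivity), sub_mul, mul_one_div_cancel hp0, one_mul] at h2

namespace IsLayeredOccupancy

variable {S A : Type*} [Fintype S] [Fintype A] {H : ℕ} {layer : S → ℕ}
  {P : S → A → S → ℝ} {π x : S → A → ℝ} {Q : (S → A → ℝ) → S → A → ℝ} {V : (S → A → ℝ) → S → ℝ}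

lemma backward_induction (hM : IsLayeredOccupancy H layer P π x) {p : S → Prop}
    (step : ∀ s, (∀ s', layer s' = layer s + 1 → p s') → p s) (s : S) : p s := by
  have key : ∀ n s, H < layer s + n → p s := by
    intro n
    induction n with
    | zero => intro s hs; exact absurd (hM.layer_le s) (by omega)
    | succ n ih => intro s hs; exact step s fun s' hs' => ih s' (by omega)
  exact key (H + 1) s (by omega)

lemma kernel_mul_congr (hM : IsLayeredOccupancy H layer P π x) {s : S} {f g : S → ℝ}
    (hfg : ∀ s', layer s' = layer s + 1 → f s' = g s') (a : A) :
    ∑ s', P s a s' * f s' = ∑ s', P s a s' * g s' := by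
  refine Finset.sum_congr rfl fun s' _ => ?_
  by_cases h : P s a s' = 0
  · simp [h]
  · rw [hfg s' (hM.kernel_supp s a s' h)]

/-- The contribution of a layer to the expected unit loss passes on to the next layer. -/
lemma layer_sum_step (hM : IsLayeredOccupancy H layer P π x)
    (hV : IsValueFunction P π Q V) (ℓ : S → A → ℝ) {h : ℕ} (hh : 1 ≤ h) :
    ∑ s with layer s = h, ∑ a, x s a * Q ℓ s a =
      ∑ s with layer s = h, ∑ a, x s a * ℓ s a +
        ∑ s with layer s = h + 1, ∑ a, x s a * Q ℓ s a := by
  have hnext : ∀ s' ∈ Finset.univ.filter (fun s => layer s = h + 1),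
      ∑ a, x s' a * Q ℓ s' a =
        ∑ s with layer s = h, ∑ a, x s a * (P s a s' * V ℓ s') := by
    intro s' hs'
    rw [Finset.mem_filter] at hs'
    have hXV : ∑ a, x s' a * Q ℓ s' a = (∑ a, x s' a) * V ℓ s' := by
      rw [hV.state_value ℓ s', Finset.mul_sum]
      refine Finset.sum_congr rfl fun a _ => ?_
      rw [hM.eq_policy_mul s' a]
      ring
    rw [hXV, hM.flow s' (by omega), Finset.sum_mul, Finset.sum_filter]
    refine Finset.sum_congr rfl fun s _ => ?_
    split_ifs with hs
    · rw [Finset.sum_mul]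
      exact Finset.sum_congr rfl fun a _ => by ring
    · have : ∀ a, P s a s' = 0 := fun a => by
        by_contra hP
        have := hM.kernel_supp s a s' hP
        omega
      simp [this]
  rw [Finset.sum_congr rfl hnext,
    Finset.sum_comm (s := Finset.univ.filter fun s => layer s = h + 1), ← Finset.sum_add_distrib]
  refine Finset.sum_congr rfl fun s hs => ?_
  rw [Finset.mem_filter] at hs
  rw [Finset.sum_comm (s := Finset.univ.filter fun s => layer s = h + 1),
    ← Finset.sum_add_distrib]
  refine Finset.sum_congr rfl fun a _ => ?_
  rw [hV.action_value, mul_add, Finset.mul_sum, Finset.sum_filter]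
  congr 1
  refine Finset.sum_congr rfl fun s' _ => ?_
  split_ifs with hs'
  · rfl
  · have : P s a s' = 0 := by
      by_contra hP
      have := hM.kernel_supp s a s' hP
      omega
    simp [this]

lemma sum_policy_mul_rpow_le (hM : IsLayeredOccupancy H layer P π x) {p : ℝ} (hp : 1 ≤ p)
    (s : S) (a : A) :
    ∑ a', π s a' * x s a' ^ (1 / p - 1) ≤
      (Fintype.card A : ℝ) ^ (1 - 1 / p) * x s a ^ (1 / p - 1) := by
  have hle : x s a ≤ ∑ b, x s b :=
    Finset.single_le_sum (fun b _ => (hM.pos s b).le) (Finset.mem_univ a)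
  have hX : 0 < ∑ b, x s b := (hM.pos s a).trans_le hle
  have hterm : ∀ a', π s a' * x s a' ^ (1 / p - 1) = x s a' ^ (1 / p) / ∑ b, x s b := by
    intro a'
    have hx := (hM.pos s a').ne'
    rw [Real.rpow_sub_one hx, eq_div_of_mul_eq hX.ne' (hM.eq_policy_mul s a').symm]
    field_simp
  have hr : 1 / p ≤ 1 := by rw [div_le_one (by linarith)]; exact hp
  rw [Finset.sum_congr rfl fun a' _ => hterm a', ← Finset.sum_div]
  calc (∑ a', x s a' ^ (1 / p)) / ∑ b, x s b
      ≤ (Fintype.card A : ℝ) ^ (1 - 1 / p) * (∑ b, x s b) ^ (1 / p) / ∑ b, x s b :=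
        div_le_div_of_nonneg_right (sum_rpow_inv_le (fun b => (hM.pos s b).le) hp) hX.le
    _ = (Fintype.card A : ℝ) ^ (1 - 1 / p) * (∑ b, x s b) ^ (1 / p - 1) := by
        rw [mul_div_assoc, Real.rpow_sub_one hX.ne']
    _ ≤ _ := mul_le_mul_of_nonneg_left
        (Real.rpow_le_rpow_of_nonpos (hM.pos s a) hle (by linarith)) (by positivity)

variable [DecidableEq S] [DecidableEq A]

lemma value_eq_sum_unitLoss (hM : IsLayeredOccupancy H layer P π x)
    (hV : IsValueFunction P π Q V) (ℓ : S → A → ℝ) (s : S) :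
    V ℓ s = ∑ z, ∑ b, ℓ z b * V (unitLoss z b) s := by
  refine hM.backward_induction
    (p := fun s => V ℓ s = ∑ z, ∑ b, ℓ z b * V (unitLoss z b) s) (fun s ih => ?_) s
  have hQ : ∀ a, Q ℓ s a = ∑ z, ∑ b, ℓ z b * Q (unitLoss z b) s a := by
    intro a
    simp only [hV.action_value, mul_add, Finset.sum_add_distrib, sum_mul_unitLoss]
    rw [hM.kernel_mul_congr ih]
    simp only [Finset.mul_sum]
    rw [Finset.sum_comm]
    congr 1
    refine Finset.sum_congr rfl fun z _ => ?_
    rw [Finset.sum_comm]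
    refine Finset.sum_congr rfl fun b _ => Finset.sum_congr rfl fun s' _ => by ring
  simp only [hV.state_value _ s, hQ, Finset.mul_sum]
  rw [Finset.sum_comm]
  refine Finset.sum_congr rfl fun z _ => ?_
  rw [Finset.sum_comm]
  refine Finset.sum_congr rfl fun b _ => Finset.sum_congr rfl fun a _ => by ring

lemma continuation_eq_sum_unitLoss (hM : IsLayeredOccupancy H layer P π x)
    (hV : IsValueFunction P π Q V) (ℓ : S → A → ℝ) (s : S) (a : A) :
    ∑ s', P s a s' * V ℓ s' = ∑ z, ∑ b, ℓ z b * ∑ s', P s a s' * V (unitLoss z b) s' := by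
  simp only [hM.value_eq_sum_unitLoss hV ℓ, Finset.mul_sum]
  rw [Finset.sum_comm]
  refine Finset.sum_congr rfl fun z _ => ?_
  rw [Finset.sum_comm]
  refine Finset.sum_congr rfl fun b _ => Finset.sum_congr rfl fun s' _ => by ring

lemma continuation_nonneg (hM : IsLayeredOccupancy H layer P π x)
    (hV : IsValueFunction P π Q V) (z : S) (b : A) (s : S) (a : A) :
    0 ≤ ∑ s', P s a s' * V (unitLoss z b) s' := by
  refine Finset.sum_nonneg fun s' _ => mul_nonneg (hM.kernel_nonneg s a s') ?_
  refine hM.backward_induction (p := fun s => 0 ≤ V (unitLoss z b) s) (fun s ih => ?_) s'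
  rw [hV.state_value]
  refine Finset.sum_nonneg fun a _ => mul_nonneg (hM.policy_nonneg s a) ?_
  rw [hV.action_value]
  refine add_nonneg (unitLoss_nonneg z b s a) (Finset.sum_nonneg fun s' _ => ?_)
  by_cases h : P s a s' = 0
  · simp [h]
  · exact mul_nonneg (hM.kernel_nonneg s a s') (ih s' (hM.kernel_supp s a s' h))

lemma value_unitLoss_eq_zero (hM : IsLayeredOccupancy H layer P π x)
    (hV : IsValueFunction P π Q V) (z : S) (b : A) (s : S) (hs : layer z < layer s) :
    V (unitLoss z b) s = 0 := by
  refine hM.backward_induction (p := fun s => layer z < layer s → V (unitLoss z b) s = 0)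
    (fun s ih hs => ?_) s hs
  have hne : s ≠ z := by rintro rfl; omega
  rw [hV.state_value]
  refine Finset.sum_eq_zero fun a _ => ?_
  rw [hV.action_value, hM.kernel_mul_congr (g := fun _ => 0) fun s' hs' => ih s' hs' (by omega)]
  simp [unitLoss, hne]

lemma continuation_le_one (hM : IsLayeredOccupancy H layer P π x)
    (hV : IsValueFunction P π Q V) (z : S) (b : A) (s : S) (a : A) :
    ∑ s', P s a s' * V (unitLoss z b) s' ≤ 1 := by
  have aux : ∀ s a, (∀ s', layer s' = layer s + 1 → V (unitLoss z b) s' ≤ 1) →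
      ∑ s', P s a s' * V (unitLoss z b) s' ≤ 1 := by
    intro s a h
    refine le_trans (Finset.sum_le_sum fun s' _ => ?_) (hM.kernel_sum_le s a)
    by_cases hP : P s a s' = 0
    · simp [hP]
    · exact mul_le_of_le_one_right (hM.kernel_nonneg s a s') (h s' (hM.kernel_supp s a s' hP))
  refine aux s a fun s' _ => ?_
  refine hM.backward_induction (p := fun s => V (unitLoss z b) s ≤ 1) (fun s ih => ?_) s'
  rw [hV.state_value, ← hM.policy_sum s]
  refine Finset.sum_le_sum fun a _ => mul_le_of_le_one_right (hM.policy_nonneg s a) ?_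
  rw [hV.action_value]
  by_cases h : s = z ∧ a = b
  · rw [hM.kernel_mul_congr (g := fun _ => 0) fun s' hs' =>
      hM.value_unitLoss_eq_zero hV z b s' (by rw [hs', h.1]; omega)]
    simp [unitLoss, h]
  · simpa [unitLoss, h] using aux s a ih

lemma layer_sum_unitLoss_le (hM : IsLayeredOccupancy H layer P π x)
    (hV : IsValueFunction P π Q V) (z : S) (b : A) {h : ℕ} (hh : 1 ≤ h) :
    ∑ s with layer s = h, ∑ a, x s a * Q (unitLoss z b) s a ≤
      if h ≤ layer z then x z b else 0 := by
  have key : ∀ n h, 1 ≤ h → H < h + n →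
      ∑ s with layer s = h, ∑ a, x s a * Q (unitLoss z b) s a ≤
        if h ≤ layer z then x z b else 0 := by
    intro n
    induction n with
    | zero =>
      intro h _ hH
      rw [Finset.filter_false_of_mem fun s _ => by have := hM.layer_le s; omega,
        Finset.sum_empty]
      split_ifs
      exacts [(hM.pos z b).le, le_rfl]
    | succ n ih =>
      intro h hh hH
      have hunit : ∑ s with layer s = h, ∑ a, x s a * unitLoss z b s a =
          if layer z = h then x z b else 0 := by
        rw [Finset.sum_filter, Finset.sum_eq_single z, Finset.sum_eq_single b]
        · simp [unitLoss]
        · intro a _ ha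
          simp [unitLoss, ha]
        · simp
        · intro s _ hs
          simp [unitLoss, hs]
        · simp
      rw [hM.layer_sum_step hV _ hh, hunit]
      have hstep := ih (h + 1) (by omega) (by omega)
      split_ifs at hstep ⊢ <;> first | omega | linarith
  exact key (H + 1) h hh (by omega)

/-- The occupancy of `(z, b)` is at least the part of it passing through `(s, a)`. -/
lemma mul_continuation_le (hM : IsLayeredOccupancy H layer P π x)
    (hV : IsValueFunction P π Q V) (z : S) (b : A) (s : S) (a : A) :
    x s a * ∑ s', P s a s' * V (unitLoss z b) s' ≤ x z b := by
  have hQ : ∀ s a, 0 ≤ x s a * Q (unitLoss z b) s a := fun s a =>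
    mul_nonneg (hM.pos s a).le <| by
      rw [hV.action_value]
      exact add_nonneg (unitLoss_nonneg z b s a) (hM.continuation_nonneg hV z b s a)
  calc x s a * ∑ s', P s a s' * V (unitLoss z b) s' ≤ x s a * Q (unitLoss z b) s a := by
        refine mul_le_mul_of_nonneg_left ?_ (hM.pos s a).le
        rw [hV.action_value]
        exact le_add_of_nonneg_left (unitLoss_nonneg z b s a)
    _ ≤ ∑ a, x s a * Q (unitLoss z b) s a :=
        Finset.single_le_sum (fun a _ => hQ s a) (Finset.mem_univ a)
    _ ≤ ∑ r with layer r = layer s, ∑ a, x r a * Q (unitLoss z b) r a :=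
        Finset.single_le_sum (f := fun r => ∑ a, x r a * Q (unitLoss z b) r a)
          (fun r _ => Finset.sum_nonneg fun a _ => hQ r a) (by simp)
    _ ≤ if layer s ≤ layer z then x z b else 0 :=
        hM.layer_sum_unitLoss_le hV z b (hM.layer_pos s)
    _ ≤ x z b := by
        split_ifs
        exacts [le_rfl, (hM.pos z b).le]

lemma abs_continuation_le (hM : IsLayeredOccupancy H layer P π x)
    (hV : IsValueFunction P π Q V) {ℓ : S → A → ℝ} {K r : ℝ} (hK : 0 ≤ K) (hr : 0 < r)
    (hr1 : r ≤ 1) (hℓ : ∀ z b, |ℓ z b| ≤ K * x z b ^ (r - 1)) (s : S) (a : A) :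
    |∑ s', P s a s' * V ℓ s'| ≤
      Fintype.card S * Fintype.card A * K * x s a ^ (r - 1) := by
  have hterm : ∀ z b, |ℓ z b * ∑ s', P s a s' * V (unitLoss z b) s'| ≤
      K * x s a ^ (r - 1) := by
    intro z b
    have h0 := hM.continuation_nonneg hV z b s a
    rw [abs_mul, abs_of_nonneg h0]
    refine (mul_le_mul_of_nonneg_right (hℓ z b) h0).trans ?_
    rw [mul_assoc]
    exact mul_le_mul_of_nonneg_left (rpow_sub_one_mul_le (hM.pos s a) h0
      (hM.continuation_le_one hV z b s a) (hM.mul_continuation_le hV z b s a) hr hr1) hK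
  rw [hM.continuation_eq_sum_unitLoss hV]
  refine (Finset.abs_sum_le_sum_abs _ _).trans ((Finset.sum_le_sum fun z _ =>
    (Finset.abs_sum_le_sum_abs _ _).trans (Finset.sum_le_sum fun b _ => hterm z b)).trans ?_)
  simp only [Finset.sum_const, Finset.card_univ, nsmul_eq_mul]
  exact le_of_eq (by ring)

lemma abs_continuation_sub_le (hM : IsLayeredOccupancy H layer P π x)
    (hV : IsValueFunction P π Q V) {ℓ : S → A → ℝ} {K p : ℝ} (hK : 0 ≤ K) (hp : 1 ≤ p)
    (hℓ : ∀ z b, |ℓ z b| ≤ K * x z b ^ (1 / p - 1)) (s : S) (a : A) :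
    |∑ s', P s a s' * V ℓ s' - ∑ a', π s a' * ∑ s', P s a' s' * V ℓ s'| ≤
      Fintype.card S * Fintype.card A * (1 + (Fintype.card A : ℝ) ^ (1 - 1 / p)) * K *
        x s a ^ (1 / p - 1) := by
  have hr : 1 / p ≤ 1 := by rw [div_le_one (by linarith)]; exact hp
  have hW := hM.abs_continuation_le hV hK (by positivity : 0 < 1 / p) hr hℓ s
  have hmean : |∑ a', π s a' * ∑ s', P s a' s' * V ℓ s'| ≤
      Fintype.card S * Fintype.card A * K *
        ((Fintype.card A : ℝ) ^ (1 - 1 / p) * x s a ^ (1 / p - 1)) := by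
    refine (Finset.abs_sum_le_sum_abs _ _).trans (le_trans ?_
      (mul_le_mul_of_nonneg_left (hM.sum_policy_mul_rpow_le hp s a) (by positivity)))
    rw [Finset.mul_sum]
    refine Finset.sum_le_sum fun a' _ => ?_
    rw [abs_mul, abs_of_nonneg (hM.policy_nonneg s a')]
    exact (mul_le_mul_of_nonneg_left (hW a') (hM.policy_nonneg s a')).trans (le_of_eq (by ring))
  exact (abs_sub _ _).trans ((add_le_add (hW a) hmean).trans (le_of_eq (by ring)))

end IsLayeredOccupancy

theorem stmt_1
    {S A : Type*} [Fintype S] [Fintype A] [Nonempty S] [Nonempty A]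
    [DecidableEq S] [DecidableEq A]
    (H : ℕ) (hH : 1 ≤ H)
    (layer : S → ℕ)
    (hlayer : ∀ s : S, 1 ≤ layer s ∧ layer s ≤ H)
    (hlayer_ne : ∀ h : ℕ, 1 ≤ h → h ≤ H → ∃ s : S, layer s = h)
    (s1 : S) (hs1 : ∀ s : S, (layer s = 1 ↔ s = s1))
    (P : S → A → S → ℝ)
    (hP_nonneg : ∀ s a s', 0 ≤ P s a s')
    (hP_supp : ∀ s a s', P s a s' ≠ 0 → layer s' = layer s + 1)
    (hP_sum : ∀ s a, layer s < H → ∑ s', P s a s' = 1)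
    (π : S → A → ℝ)
    (hπ_nonneg : ∀ s a, 0 ≤ π s a)
    (hπ_sum : ∀ s, ∑ a, π s a = 1)
    (x : S → A → ℝ)
    (hx_init : ∀ a, x s1 a = π s1 a)
    (hx_rec : ∀ s' a', 2 ≤ layer s' → x s' a' = π s' a' * ∑ s, ∑ a, P s a s' * x s a)
    (hx_pos : ∀ s a, 0 < x s a)
    (Q : (S → A → ℝ) → S → A → ℝ) (V : (S → A → ℝ) → S → ℝ)
    (hQ : ∀ ℓ s a, Q ℓ s a = ℓ s a + ∑ s', P s a s' * V ℓ s')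
    (hV : ∀ ℓ s, V ℓ s = ∑ a, π s a * Q ℓ s a)
    (α σ C t : ℝ)
    (hα1 : 1 < α) (hα2 : α ≤ 2) (hσ : 0 < σ) (hC : 0 < C) (ht : 1 ≤ t)
    (traj : Fin H → S × A)
    (htraj_layer : ∀ h : Fin H, layer (traj h).1 = (h : ℕ) + 1)
    (htraj_pi : ∀ h : Fin H, 0 < π (traj h).1 (traj h).2)
    (htraj_P : ∀ (h : Fin H) (hh : (h : ℕ) + 1 < H),
      0 < P (traj h).1 (traj h).2 (traj ⟨(h : ℕ) + 1, hh⟩).1)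
    (ℓ : S → A → ℝ)
    (ℓskip : S → A → ℝ)
    (hℓskip : ∀ s a, ℓskip s a =
      (if ∃ h : Fin H, traj h = (s, a) then
        (if |ℓ s a| ≤ C * σ * t ^ (1/α) * x s a ^ (1/α) then ℓ s a else 0) / x s a
      else 0))
    :
    ∀ s a,
      |(∑ s', P s a s' * V ℓskip s') - ∑ a' : A, π s a' * ∑ s', P s a' s' * V ℓskip s'| ≤
        (H : ℝ) * (Fintype.card S : ℝ) * (Fintype.card A : ℝ) *
          (1 + (Fintype.card A : ℝ) ^ (1 - 1/α)) * C * σ * t ^ (1/α) * x s a ^ (1/α - 1) := by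
  intro s a
  have hmass : ∀ s' : S, ∃ X : ℝ, ∀ a, x s' a = π s' a * X := by
    intro s'
    rcases (hlayer s').1.eq_or_lt with h | h
    · obtain rfl := (hs1 s').1 h.symm
      exact ⟨1, fun a => by rw [hx_init, mul_one]⟩
    · exact ⟨_, fun a => hx_rec s' a h⟩
  have hM : IsLayeredOccupancy H layer P π x :=
    { layer_pos := fun s => (hlayer s).1
      layer_le := fun s => (hlayer s).2
      kernel_nonneg := hP_nonneg
      kernel_supp := hP_supp
      kernel_sum_le := fun s a => by
        rcases (hlayer s).2.lt_or_eq with h | h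
        · exact (hP_sum s a h).le
        · rw [Finset.sum_eq_zero fun s' _ => ?_]
          · exact zero_le_one
          · by_contra hP
            have := hP_supp s a s' hP
            have := (hlayer s').2
            omega
      policy_nonneg := hπ_nonneg
      policy_sum := hπ_sum
      pos := hx_pos
      eq_policy_mul := fun s a => by
        obtain ⟨X, hX⟩ := hmass s
        simp only [hX, ← Finset.sum_mul, hπ_sum, one_mul]
      flow := fun s' hs' => by
        simp only [hx_rec s' _ hs', ← Finset.sum_mul, hπ_sum, one_mul] }
  have hK : 0 ≤ C * σ * t ^ (1 / α) := by positivity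
  have hskip : ∀ z b, |ℓskip z b| ≤ C * σ * t ^ (1 / α) * x z b ^ (1 / α - 1) := by
    intro z b
    have hx := hx_pos z b
    rw [hℓskip, Real.rpow_sub_one hx.ne', ← mul_div_assoc]
    split_ifs with h1 h2
    · rw [abs_div, abs_of_pos hx]
      exact div_le_div_of_nonneg_right h2 hx.le
    · rw [zero_div, abs_zero]
      positivity
    · rw [abs_zero]
      positivity
  refine (hM.abs_continuation_sub_le ⟨hQ, hV⟩ hK hα1.le hskip s a).trans ?_
  have hH' : (1 : ℝ) ≤ H := by exact_mod_cast hH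
  have hx := Real.rpow_nonneg (hx_pos s a).le (1 / α - 1)
  refine (le_mul_of_one_le_left (by positivity) hH').trans (le_of_eq (by ring))
end

section
/- Suboptimal mass propagation: let π be any policy and π† be a deterministic policy of the layered MDP. Then ∑_{s ∈ 𝒮} (ρ^{ℙ,π}(s) − ρ^{ℙ,π†}(s))_+ ≤ H · ∑_{(s,a): a ≠ π†(s)} ρ^{ℙ,π}(s,a), where (u)_+ = max{u, 0}. -/
open Finset MeasureTheory

open scoped Classical

/-- If the mass `D` of each layer is dominated by a flow `c` out of the previous layer which gains at
most `E s` at every `s`, then the mass of layer `h` is at most the total gain below layer `h`. -/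
theorem sum_layer_le_of_flow {S : Type*} [Fintype S] (layer : S → ℕ) (D E : S → ℝ) (c : S → S → ℝ)
    (hc : ∀ s s', 0 ≤ c s s') (hc_supp : ∀ s s', c s s' ≠ 0 → layer s' = layer s + 1)
    (hc_sum : ∀ s, ∑ s', c s s' ≤ D s + E s) (hE : ∀ s, 0 ≤ E s)
    (hD_init : ∀ s, layer s ≤ 1 → D s ≤ 0)
    (hD_step : ∀ s', 2 ≤ layer s' → D s' ≤ ∑ s, c s s') (h : ℕ) :
    ∑ s with layer s = h, D s ≤ ∑ s with layer s < h, E s := by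
  induction h with
  | zero =>
    exact (Finset.sum_nonpos fun s hs => hD_init s (by simp at hs; lia)).trans
      (Finset.sum_nonneg fun s _ => hE s)
  | succ h ih =>
    rcases Nat.eq_zero_or_pos h with rfl | hpos
    · exact (Finset.sum_nonpos fun s hs => hD_init s (by simp at hs; lia)).trans
        (Finset.sum_nonneg fun s _ => hE s)
    have hsplit : ∑ s with layer s < h + 1, E s
        = ∑ s with layer s = h, E s + ∑ s with layer s < h, E s := by
      rw [← Finset.sum_union (Finset.disjoint_filter.2 fun s _ h1 h2 => by lia)]
      congr 1
      ext s
      simp only [Finset.mem_filter, Finset.mem_union, Finset.mem_univ, true_and]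
      lia
    calc ∑ s' with layer s' = h + 1, D s'
        ≤ ∑ s' with layer s' = h + 1, ∑ s with layer s = h, c s s' := by
          refine Finset.sum_le_sum fun s' hs' => ?_
          have hs' : layer s' = h + 1 := by simpa using hs'
          refine (hD_step s' (by lia)).trans_eq (Finset.sum_filter_of_ne fun s _ hne => ?_).symm
          have := hc_supp s s' hne
          lia
      _ = ∑ s with layer s = h, ∑ s' with layer s' = h + 1, c s s' := Finset.sum_comm
      _ ≤ ∑ s with layer s = h, (D s + E s) := Finset.sum_le_sum fun s _ =>
          (Finset.sum_le_sum_of_subset_of_nonneg (Finset.filter_subset _ _)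
            fun s' _ _ => hc s s').trans (hc_sum s)
      _ ≤ ∑ s with layer s < h + 1, E s := by
          rw [Finset.sum_add_distrib, hsplit]
          linarith

theorem sum_le_mul_sum_of_flow {S : Type*} [Fintype S] (H : ℕ) (layer : S → ℕ)
    (hlayer : ∀ s : S, 1 ≤ layer s ∧ layer s ≤ H) (D E : S → ℝ) (c : S → S → ℝ)
    (hc : ∀ s s', 0 ≤ c s s') (hc_supp : ∀ s s', c s s' ≠ 0 → layer s' = layer s + 1)
    (hc_sum : ∀ s, ∑ s', c s s' ≤ D s + E s) (hE : ∀ s, 0 ≤ E s)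
    (hD_init : ∀ s, layer s ≤ 1 → D s ≤ 0)
    (hD_step : ∀ s', 2 ≤ layer s' → D s' ≤ ∑ s, c s s') :
    ∑ s, D s ≤ H * ∑ s, E s := by
  rw [← Finset.sum_fiberwise_of_maps_to (t := Finset.Icc 1 H) (g := layer)
    (fun s _ => Finset.mem_Icc.2 (hlayer s)) D]
  refine (Finset.sum_le_card_nsmul _ _ (∑ s, E s) fun h _ => ?_).trans_eq (by simp)
  exact (sum_layer_le_of_flow layer D E c hc hc_supp hc_sum hE hD_init hD_step h).trans
    (Finset.sum_le_sum_of_subset_of_nonneg (Finset.filter_subset _ _) fun s _ _ => hE s)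

theorem occupancy_nonneg {S A : Type*} [Fintype S] [Fintype A] (layer : S → ℕ)
    (P : S → A → S → ℝ) (hP_nonneg : ∀ s a s', 0 ≤ P s a s')
    (hP_supp : ∀ s a s', P s a s' ≠ 0 → layer s' = layer s + 1)
    (π : S → A → ℝ) (hπ_nonneg : ∀ s a, 0 ≤ π s a) (x : S → A → ℝ)
    (hx_init : ∀ s a, layer s ≤ 1 → 0 ≤ x s a)
    (hx_rec : ∀ s' a', 2 ≤ layer s' → x s' a' = π s' a' * ∑ s, ∑ a, P s a s' * x s a)
    (s : S) (a : A) : 0 ≤ x s a := by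
  induction hn : layer s using Nat.strong_induction_on generalizing s a with
  | _ n ih =>
    by_cases h1 : layer s ≤ 1
    · exact hx_init s a h1
    rw [hx_rec s a (by lia)]
    refine mul_nonneg (hπ_nonneg s a)
      (Finset.sum_nonneg fun t _ => Finset.sum_nonneg fun b _ => ?_)
    by_cases hP : P t b s = 0
    · simp [hP]
    · have := hP_supp t b s hP
      exact mul_nonneg (hP_nonneg t b s) (ih (layer t) (by lia) t b rfl)

theorem sum_transition_le_one {S A : Type*} [Fintype S] (H : ℕ) (layer : S → ℕ)
    (hlayer : ∀ s : S, 1 ≤ layer s ∧ layer s ≤ H) (P : S → A → S → ℝ)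
    (hP_supp : ∀ s a s', P s a s' ≠ 0 → layer s' = layer s + 1)
    (hP_sum : ∀ s a, layer s < H → ∑ s', P s a s' = 1) (s : S) (a : A) :
    ∑ s', P s a s' ≤ 1 := by
  by_cases h : layer s < H
  · exact (hP_sum s a h).le
  · refine (Finset.sum_nonpos fun s' _ => ?_).trans zero_le_one
    by_contra! hne
    have := hP_supp s a s' hne.ne'
    have := (hlayer s').2
    lia

theorem stmt_4
    {S A : Type*} [Fintype S] [Fintype A] [Nonempty S] [Nonempty A]
    [DecidableEq S] [DecidableEq A]
    (H : ℕ) (hH : 1 ≤ H)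
    (layer : S → ℕ)
    (hlayer : ∀ s : S, 1 ≤ layer s ∧ layer s ≤ H)
    (hlayer_ne : ∀ h : ℕ, 1 ≤ h → h ≤ H → ∃ s : S, layer s = h)
    (s1 : S) (hs1 : ∀ s : S, (layer s = 1 ↔ s = s1))
    (P : S → A → S → ℝ)
    (hP_nonneg : ∀ s a s', 0 ≤ P s a s')
    (hP_supp : ∀ s a s', P s a s' ≠ 0 → layer s' = layer s + 1)
    (hP_sum : ∀ s a, layer s < H → ∑ s', P s a s' = 1)
    (π : S → A → ℝ)
    (hπ_nonneg : ∀ s a, 0 ≤ π s a)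
    (hπ_sum : ∀ s, ∑ a, π s a = 1)
    (x : S → A → ℝ)
    (hx_init : ∀ a, x s1 a = π s1 a)
    (hx_rec : ∀ s' a', 2 ≤ layer s' → x s' a' = π s' a' * ∑ s, ∑ a, P s a s' * x s a)
    (πd : S → A)
    (ρ : S → A → ℝ)
    (hρ_init : ∀ a, ρ s1 a = if a = πd s1 then (1:ℝ) else 0)
    (hρ_rec : ∀ s' a', 2 ≤ layer s' →
      ρ s' a' = (if a' = πd s' then (1:ℝ) else 0) * ∑ s, ∑ a, P s a s' * ρ s a)
    :
    ∑ s, max ((∑ a, x s a) - ∑ a, ρ s a) 0 ≤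
      (H : ℝ) * ∑ s, ∑ a ∈ Finset.univ.filter (fun a => a ≠ πd s), x s a := by
  have hx_nonneg : ∀ s a, 0 ≤ x s a :=
    occupancy_nonneg layer P hP_nonneg hP_supp π hπ_nonneg x
      (fun s a hs => by
        rw [(hs1 s).1 (le_antisymm hs (hlayer s).1), hx_init]
        exact hπ_nonneg s1 a) hx_rec
  have hP_le := sum_transition_le_one H layer hlayer P hP_supp hP_sum
  have hρ_off : ∀ s a, a ≠ πd s → ρ s a = 0 := by
    intro s a ha
    by_cases hs : layer s = 1
    · obtain rfl := (hs1 s).1 hs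
      simp [hρ_init, ha]
    · have := (hlayer s).1
      simp [hρ_rec s a (by lia), ha]
  have hsplit : ∀ (s : S) (f : A → ℝ), ∑ a, f a = f (πd s) + ∑ a with a ≠ πd s, f a := by
    intro s f
    rw [Finset.filter_ne', Finset.add_sum_erase _ _ (Finset.mem_univ _)]
  have hρ_sum : ∀ s, ∑ a, ρ s a = ρ s (πd s) := fun s =>
    Finset.sum_eq_single _ (fun a _ ha => hρ_off s a ha) (by simp)
  have hE : ∀ s, 0 ≤ ∑ a with a ≠ πd s, x s a := fun s =>
    Finset.sum_nonneg fun a _ => hx_nonneg s a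
  refine sum_le_mul_sum_of_flow H layer hlayer _ _
    (fun s s' => P s (πd s) s' * max ((∑ a, x s a) - ∑ a, ρ s a) 0
      + ∑ a with a ≠ πd s, P s a s' * x s a) ?_ ?_ ?_ hE ?_ ?_
  · exact fun s s' => add_nonneg (mul_nonneg (hP_nonneg _ _ _) (le_max_right _ _))
      (Finset.sum_nonneg fun a _ => mul_nonneg (hP_nonneg _ _ _) (hx_nonneg _ _))
  · intro s s' hne
    by_contra hl
    have hP0 : ∀ a, P s a s' = 0 := fun a => by_contra fun h => hl (hP_supp s a s' h)
    exact hne (by simp [hP0])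
  · intro s
    rw [Finset.sum_add_distrib, ← Finset.sum_mul, Finset.sum_comm]
    refine add_le_add (mul_le_of_le_one_left (le_max_right _ _) (hP_le _ _))
      (Finset.sum_le_sum fun a _ => ?_)
    rw [← Finset.sum_mul]
    exact mul_le_of_le_one_left (hx_nonneg _ _) (hP_le _ _)
  · intro s hs
    obtain rfl := (hs1 s).1 (le_antisymm hs (hlayer s).1)
    simp [hx_init, hρ_init, hπ_sum]
  · intro s' hs'
    refine max_le ?_ (Finset.sum_nonneg fun s _ => add_nonneg
      (mul_nonneg (hP_nonneg _ _ _) (le_max_right _ _))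
      (Finset.sum_nonneg fun a _ => mul_nonneg (hP_nonneg _ _ _) (hx_nonneg _ _)))
    have hX : ∑ a, x s' a = ∑ s, ∑ a, P s a s' * x s a := by
      rw [Finset.sum_congr rfl fun a _ => hx_rec s' a hs', ← Finset.sum_mul, hπ_sum, one_mul]
    have hR : ∑ a, ρ s' a = ∑ s, P s (πd s) s' * ρ s (πd s) := by
      rw [hρ_sum, hρ_rec s' _ hs', if_pos rfl, one_mul]
      exact Finset.sum_congr rfl fun s _ =>
        Finset.sum_eq_single _ (fun a _ ha => by simp [hρ_off s a ha]) (by simp)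
    rw [hX, hR, ← Finset.sum_sub_distrib]
    refine Finset.sum_le_sum fun s _ => ?_
    have hle : x s (πd s) - ρ s (πd s) ≤ max ((∑ a, x s a) - ∑ a, ρ s a) 0 := by
      refine le_max_of_le_left ?_
      rw [hρ_sum, hsplit s (x s)]
      linarith [hE s]
    have := mul_le_mul_of_nonneg_left hle (hP_nonneg s (πd s) s')
    rw [hsplit s fun a => P s a s' * x s a]
    linarith
end

section
/- One-step recursion for occupancy deviations: let π be any policy and π† a deterministic policy of the layered MDP, and define f(s) := (ρ^{ℙ,π}(s) − ρ^{ℙ,π†}(s))_+. Then for every layer index h ≥ 2 and every state s ∈ 𝒮_h, f(s) ≤ ∑_{s' ∈ 𝒮_{h−1}} ℙ[s|s', π†(s')] f(s') + ∑_{s' ∈ 𝒮_{h−1}} ∑_{a' ≠ π†(s')} ℙ[s|s',a'] ρ^{ℙ,π}(s',a'). -/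
open Finset MeasureTheory

open scoped Classical

/-- Splitting off the action `d`: if `ρ` is concentrated on `d` and `x` is nonnegative, the weighted
deviation of `x` from `ρ` is at most the deviation of the total masses at `d` plus the weighted mass
that `x` puts on the other actions. -/
theorem sum_mul_sub_sum_mul_le_of_concentrated {A : Type*} [Fintype A] [DecidableEq A]
    (p x ρ : A → ℝ) (d : A) (hp : ∀ a, 0 ≤ p a) (hx : ∀ a, 0 ≤ x a)
    (hρ : ∀ a, a ≠ d → ρ a = 0) :
    ∑ a, p a * x a - ∑ a, p a * ρ a ≤
      p d * max (∑ a, x a - ∑ a, ρ a) 0 + ∑ a ∈ univ.filter (fun a => a ≠ d), p a * x a := by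
  have h_mass : ∑ a, ρ a = ρ d := Fintype.sum_eq_single d hρ
  have h_weighted : ∑ a, p a * ρ a = p d * ρ d :=
    Fintype.sum_eq_single d fun a ha => by rw [hρ a ha, mul_zero]
  have h_split : ∑ a, p a * x a = p d * x d + ∑ a ∈ univ.filter (fun a => a ≠ d), p a * x a := by
    rw [filter_ne' univ d, add_sum_erase univ (fun a => p a * x a) (mem_univ d)]
  have h_le : x d ≤ ∑ a, x a := single_le_sum (fun a _ => hx a) (mem_univ d)
  have h_max : x d - ρ d ≤ max (∑ a, x a - ∑ a, ρ a) 0 :=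
    le_max_of_le_left (by rw [h_mass]; linarith)
  have := mul_le_mul_of_nonneg_left h_max (hp d)
  rw [h_weighted, h_split]
  linarith

theorem stmt_5
    {S A : Type*} [Fintype S] [Fintype A] [Nonempty S] [Nonempty A]
    [DecidableEq S] [DecidableEq A]
    (H : ℕ) (hH : 1 ≤ H)
    (layer : S → ℕ)
    (hlayer : ∀ s : S, 1 ≤ layer s ∧ layer s ≤ H)
    (hlayer_ne : ∀ h : ℕ, 1 ≤ h → h ≤ H → ∃ s : S, layer s = h)
    (s1 : S) (hs1 : ∀ s : S, (layer s = 1 ↔ s = s1))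
    (P : S → A → S → ℝ)
    (hP_nonneg : ∀ s a s', 0 ≤ P s a s')
    (hP_supp : ∀ s a s', P s a s' ≠ 0 → layer s' = layer s + 1)
    (hP_sum : ∀ s a, layer s < H → ∑ s', P s a s' = 1)
    (π : S → A → ℝ)
    (hπ_nonneg : ∀ s a, 0 ≤ π s a)
    (hπ_sum : ∀ s, ∑ a, π s a = 1)
    (x : S → A → ℝ)
    (hx_init : ∀ a, x s1 a = π s1 a)
    (hx_rec : ∀ s' a', 2 ≤ layer s' → x s' a' = π s' a' * ∑ s, ∑ a, P s a s' * x s a)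
    (πd : S → A)
    (ρ : S → A → ℝ)
    (hρ_init : ∀ a, ρ s1 a = if a = πd s1 then (1:ℝ) else 0)
    (hρ_rec : ∀ s' a', 2 ≤ layer s' →
      ρ s' a' = (if a' = πd s' then (1:ℝ) else 0) * ∑ s, ∑ a, P s a s' * ρ s a)
    :
    ∀ s : S, 2 ≤ layer s →
      max ((∑ a, x s a) - ∑ a, ρ s a) 0 ≤
        (∑ s' ∈ Finset.univ.filter (fun s' : S => layer s' = layer s - 1),
          P s' (πd s') s * max ((∑ a, x s' a) - ∑ a, ρ s' a) 0) +
        ∑ s' ∈ Finset.univ.filter (fun s' : S => layer s' = layer s - 1),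
          ∑ a' ∈ Finset.univ.filter (fun a' => a' ≠ πd s'), P s' a' s * x s' a' := by
  have two_le : ∀ s, s ≠ s1 → 2 ≤ layer s := fun s hs => by
    have h_one := (hlayer s).1
    have h_ne := mt (hs1 s).1 hs
    omega
  have x_nonneg : ∀ n s, layer s = n → ∀ a, 0 ≤ x s a := by
    intro n
    induction n using Nat.strong_induction_on with
    | _ n ih =>
      intro s hs a
      by_cases h1 : s = s1
      · subst h1
        rw [hx_init]
        exact hπ_nonneg _ _
      · rw [hx_rec s a (two_le s h1)]
        refine mul_nonneg (hπ_nonneg _ _) (sum_nonneg fun s' _ => sum_nonneg fun b _ => ?_)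
        by_cases hP : P s' b s = 0
        · simp [hP]
        · have h_layer := hP_supp _ _ _ hP
          exact mul_nonneg (hP_nonneg _ _ _) (ih (layer s') (by omega) s' rfl b)
  have ρ_eq_zero : ∀ s a, a ≠ πd s → ρ s a = 0 := by
    intro s a ha
    by_cases h1 : s = s1
    · subst h1
      rw [hρ_init, if_neg ha]
    · rw [hρ_rec s a (two_le s h1), if_neg ha, zero_mul]
  intro s hs
  have x_mass : ∑ a, x s a = ∑ s', ∑ a, P s' a s * x s' a := by
    simp_rw [fun a => hx_rec s a hs]
    rw [← sum_mul, hπ_sum, one_mul]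
  have ρ_mass : ∑ a, ρ s a = ∑ s', ∑ a, P s' a s * ρ s' a := by
    simp_rw [fun a => hρ_rec s a hs]
    rw [← sum_mul, sum_ite_eq' univ (πd s), if_pos (mem_univ _), one_mul]
  have restrict : ∀ y : S → A → ℝ, ∑ s', ∑ a, P s' a s * y s' a =
      ∑ s' ∈ univ.filter (fun s' : S => layer s' = layer s - 1), ∑ a, P s' a s * y s' a := by
    intro y
    refine (sum_subset (filter_subset _ _) fun s' _ hs' => sum_eq_zero fun a _ => ?_).symm
    have hP : P s' a s = 0 := by
      by_contra hP
      have h_layer := hP_supp _ _ _ hP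
      exact hs' (mem_filter.2 ⟨mem_univ _, by omega⟩)
    rw [hP, zero_mul]
  rw [← sum_add_distrib]
  refine max_le ?_ (sum_nonneg fun s' _ => add_nonneg
    (mul_nonneg (hP_nonneg _ _ _) (le_max_right _ _))
    (sum_nonneg fun a _ => mul_nonneg (hP_nonneg _ _ _) (x_nonneg _ s' rfl a)))
  rw [x_mass, ρ_mass, restrict x, restrict ρ, ← sum_sub_distrib]
  exact sum_le_sum fun s' _ => sum_mul_sub_sum_mul_le_of_concentrated (fun a => P s' a s)
    (x s') (ρ s') (πd s') (fun a => hP_nonneg _ _ _) (x_nonneg _ s' rfl) (ρ_eq_zero s')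
end

section
/- Local stability of Tsallis entropy: fix α' ∈ [1/2, 1) and n ≥ 1, let x ∈ ℝ^n have strictly positive coordinates, and let g ∈ ℝ^n satisfy |g_i| ≤ ((1−α')/4) x_i^{α'−1} for all i. Define ỹ ∈ ℝ^n by ỹ_i = (x_i^{α'−1} + g_i)^{1/(α'−1)} (equivalently ∇ψ(ỹ) = ∇ψ(x) − g). Then ⟨g, x − ỹ⟩ − D_ψ(ỹ, x) ≤ (2/(1−α')) ∑_{i=1}^n x_i^{2−α'} g_i². -/
open Finset MeasureTheory

open scoped Classical

/-- Second-order upper bound for `(1 + r) ^ (-p)` near `r = 0`, a consequence of Bernoulli's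
inequality. -/
theorem one_add_rpow_neg_le {p r : ℝ} (hp : 1 ≤ p) (hr : |r| * (4 * (p + 1)) ≤ 1) :
    (1 + r) ^ (-p) ≤ 1 - p * r + 2 * p * (p + 1) * r ^ 2 := by
  have hr0 := abs_nonneg r
  have hneg := neg_abs_le r
  have hr3 : -(1 / 8) ≤ r := by nlinarith
  have hpr : 3 / 4 ≤ 1 + p * r := by
    have := mul_le_mul_of_nonneg_left hneg (show 0 ≤ p by linarith)
    linarith
  have hbern : 1 + p * r ≤ (1 + r) ^ p := one_add_mul_self_le_rpow_one_add (by linarith) hp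
  rw [Real.rpow_neg (by linarith)]
  calc ((1 + r) ^ p)⁻¹ ≤ (1 + p * r)⁻¹ := inv_anti₀ (by linarith) hbern
    _ ≤ _ := by
      rw [inv_le_iff_one_le_mul₀ (by linarith)]
      have hprod : (p + 1) * (3 / 4) ≤ (p + 1) * (1 + p * r) :=
        mul_le_mul_of_nonneg_left hpr (by linarith)
      have hrem : 0 ≤ p * r ^ 2 * (2 * ((p + 1) * (1 + p * r)) - p) :=
        mul_nonneg (by positivity) (by linarith)
      linarith

/-- One-coordinate local stability of the Tsallis entropy. -/
theorem tsallis_stability_coord {a x g y : ℝ} (ha1 : 1 / 2 ≤ a) (ha2 : a < 1) (hx : 0 < x)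
    (hg : |g| ≤ (1 - a) / 4 * x ^ (a - 1)) (hy : y = (x ^ (a - 1) + g) ^ (1 / (a - 1))) :
    g * (x - y) + 1 / a * (y ^ a - x ^ a) - x ^ (a - 1) * (y - x) ≤
      2 / (1 - a) * (x ^ (2 - a) * g ^ 2) := by
  have ha : 0 < a := by linarith
  have hb : 0 < 1 - a := by linarith
  have hw : 0 < x ^ (a - 1) := Real.rpow_pos_of_pos hx _
  obtain ⟨r, rfl⟩ : ∃ r, g = x ^ (a - 1) * r := ⟨g / x ^ (a - 1), by field_simp⟩
  have hr : |r| ≤ (1 - a) / 4 := by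
    rw [abs_mul, abs_of_pos hw, mul_comm] at hg
    exact le_of_mul_le_mul_right hg hw
  have ht : 0 < 1 + r := by linarith [neg_abs_le r]
  have hu : x ^ (a - 1) + x ^ (a - 1) * r = x ^ (a - 1) * (1 + r) := by ring
  have hupos : 0 < x ^ (a - 1) * (1 + r) := mul_pos hw ht
  have hne : a - 1 ≠ 0 := by linarith
  rw [hu] at hy
  have hypos : 0 < y := hy ▸ Real.rpow_pos_of_pos hupos _
  have hyinv : y ^ (a - 1) = x ^ (a - 1) * (1 + r) := by
    rw [hy, ← Real.rpow_mul hupos.le, one_div_mul_cancel hne, Real.rpow_one]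
  have hya : y ^ a = x ^ a * (1 + r) ^ (-(a / (1 - a))) := by
    rw [hy, ← Real.rpow_mul hupos.le, Real.mul_rpow hw.le ht.le, ← Real.rpow_mul hx.le]
    congr 2
    · field_simp
    · rw [← div_neg, neg_sub, one_div_mul_eq_div]
  have hyy : y ^ (a - 1) * y = y ^ a := by
    rw [← Real.rpow_add_one hypos.ne', sub_add_cancel]
  have hxx : x ^ (a - 1) * x = x ^ a := by
    rw [← Real.rpow_add_one hx.ne', sub_add_cancel]
  have hxsq : x ^ (2 - a) * (x ^ (a - 1) * r) ^ 2 = x ^ a * r ^ 2 := by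
    rw [mul_pow, ← mul_assoc, ← Real.rpow_mul_natCast hx.le, ← Real.rpow_add hx]
    congr 2
    push_cast
    ring
  have hp1 : a / (1 - a) + 1 = 1 / (1 - a) := by field_simp; ring
  have hbound := one_add_rpow_neg_le (p := a / (1 - a)) (r := r)
    (by rw [le_div_iff₀ hb]; linarith)
    (by rw [hp1, ← mul_div_assoc, ← mul_div_assoc, div_le_one hb]; linarith)
  rw [hp1] at hbound
  have hxa : 0 < x ^ a := Real.rpow_pos_of_pos hx _
  rw [hxsq]
  calc x ^ (a - 1) * r * (x - y) + 1 / a * (y ^ a - x ^ a) - x ^ (a - 1) * (y - x)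
      = x ^ (a - 1) * x * (1 + r) - x ^ (a - 1) * (1 + r) * y + 1 / a * (y ^ a - x ^ a) := by ring
    _ = x ^ a * (1 + r - 1 / a + (1 - a) / a * (1 + r) ^ (-(a / (1 - a)))) := by
      rw [← hyinv, hyy, hxx, hya]
      field_simp
      ring
    _ ≤ x ^ a * (1 + r - 1 / a + (1 - a) / a *
          (1 - a / (1 - a) * r + 2 * (a / (1 - a)) * (1 / (1 - a)) * r ^ 2)) := by gcongr
    _ = 2 / (1 - a) * (x ^ a * r ^ 2) := by
      field_simp
      ring

theorem stmt_6
    (α' : ℝ) (hα'1 : 1/2 ≤ α') (hα'2 : α' < 1)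
    (n : ℕ) (hn : 1 ≤ n)
    (x g ytil : Fin n → ℝ)
    (hx : ∀ i, 0 < x i)
    (hg : ∀ i, |g i| ≤ (1 - α') / 4 * x i ^ (α' - 1))
    (hy : ∀ i, ytil i = (x i ^ (α' - 1) + g i) ^ (1 / (α' - 1)))
    (ψ : (Fin n → ℝ) → ℝ)
    (hψ : ∀ z, ψ z = -(1/α') * ∑ i, (z i ^ α' - z i))
    (Dψ : (Fin n → ℝ) → (Fin n → ℝ) → ℝ)
    (hD : ∀ y w, Dψ y w = ψ y - ψ w - ∑ i, (1/α' - w i ^ (α' - 1)) * (y i - w i)) :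
    (∑ i, g i * (x i - ytil i)) - Dψ ytil x ≤
      2 / (1 - α') * ∑ i, x i ^ (2 - α') * g i ^ 2 := by
  rw [hD, hψ, hψ, mul_sum, mul_sum, mul_sum, ← sum_sub_distrib, ← sum_sub_distrib,
    ← sum_sub_distrib]
  refine sum_le_sum fun i _ => le_of_eq_of_le ?_
    (tsallis_stability_coord hα'1 hα'2 (hx i) (hg i) (hy i))
  ring
end

section
/- Stability bound for FTRL with 1/α-Tsallis regularizer: fix α ∈ (1,2], η > 0, a finite index set I (e.g., 𝒮×𝒜), a vector x ∈ ℝ^I with strictly positive entries, and vectors ℓ, b ∈ ℝ^I such that |ℓ_i − b_i| ≤ ((α−1)/(4α²η)) x_i^{1/α − 1} for all i ∈ I. Let Ψ(z) = −(1/η) ∑_{i∈I} z_i^{1/α} with Bregman divergence D_Ψ(y,x) = Ψ(y) − Ψ(x) − ⟨∇Ψ(x), y − x⟩. Then for every y ∈ ℝ^I with nonnegative entries, ⟨ℓ − b, x − y⟩ − D_Ψ(y, x) ≤ (4α²/(α−1)) · η · ∑_{i∈I} x_i^{2 − 1/α} (ℓ_i² + b_i²). -/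
open Finset MeasureTheory

open scoped Classical

/-- Bernoulli's inequality for the negative exponent `p - 1`. -/
lemma one_sub_mul_le_rpow_one_add_sub_one {p v : ℝ} (hp0 : 0 < p) (hp1 : p < 1) (hv : -1 < v) :
    1 - (1 - p) * v ≤ (1 + v) ^ (p - 1) := by
  have hv1 : 0 < 1 + v := by linarith
  have h := rpow_one_add_le_one_add_mul_self hv.le (show 0 ≤ 1 - p by linarith) (by linarith)
  have hB : 0 < (1 + v) ^ (p - 1) := Real.rpow_pos_of_pos hv1 _
  have hA : 0 < (1 + v) ^ (1 - p) := Real.rpow_pos_of_pos hv1 _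
  have hAB : (1 + v) ^ (1 - p) * (1 + v) ^ (p - 1) = 1 := by
    rw [← Real.rpow_add hv1]
    norm_num
  refine le_of_mul_le_mul_left ?_ (hA.trans_le h)
  nlinarith [mul_le_mul_of_nonneg_right h hB.le, sq_nonneg ((1 - p) * v)]

/-- The truncated binomial expansion of `(1 + w) ^ p` is an upper bound for `-1 ≤ w ≤ 0`. -/
lemma rpow_one_add_le_quadratic_of_nonpos {p w : ℝ} (hp0 : 0 < p) (hp1 : p < 1)
    (hw : -1 ≤ w) (hw0 : w ≤ 0) :
    (1 + w) ^ p ≤ 1 + p * w - p * (1 - p) / 2 * w ^ 2 := by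
  have hanti : AntitoneOn (fun v : ℝ => 1 + p * v - p * (1 - p) / 2 * v ^ 2 - (1 + v) ^ p)
      (Set.Icc (-1) 0) := by
    refine antitoneOn_of_hasDerivWithinAt_nonpos (convex_Icc _ _)
      (f' := fun v => p * (1 - (1 - p) * v - (1 + v) ^ (p - 1))) ?_ ?_ ?_
    · refine ContinuousOn.sub (by fun_prop) (ContinuousOn.rpow_const (by fun_prop) ?_)
      exact fun _ _ => Or.inr hp0.le
    · intro v hv
      rw [interior_Icc] at hv
      have hv1 : 1 + v ≠ 0 := by linarith [hv.1]
      have h := (((((hasDerivAt_id v).const_mul p).const_add 1).sub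
        (((hasDerivAt_id v).pow 2).const_mul (p * (1 - p) / 2))).sub
        (((hasDerivAt_id v).const_add 1).rpow_const (p := p) (Or.inl hv1)))
      refine (h.congr_deriv ?_).hasDerivWithinAt
      simp
      ring
    · intro v hv
      rw [interior_Icc] at hv
      have h := one_sub_mul_le_rpow_one_add_sub_one hp0 hp1 hv.1
      exact mul_nonpos_of_nonneg_of_nonpos hp0.le (by linarith)
  have h := hanti ⟨hw, hw0⟩ (Set.right_mem_Icc.2 (by norm_num)) hw0
  simp at h
  linarith

/-- The truncated binomial expansion of `(1 + w) ^ (1 + p)` is an upper bound for `0 ≤ w`. -/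
lemma rpow_one_add_le_quadratic_of_nonneg {p w : ℝ} (hp0 : 0 < p) (hp1 : p < 1) (hw : 0 ≤ w) :
    (1 + w) ^ (1 + p) ≤ 1 + (1 + p) * w + p * (1 + p) / 2 * w ^ 2 := by
  have hmono : MonotoneOn
      (fun v : ℝ => 1 + (1 + p) * v + p * (1 + p) / 2 * v ^ 2 - (1 + v) ^ (1 + p))
      (Set.Ici 0) := by
    refine monotoneOn_of_hasDerivWithinAt_nonneg (convex_Ici _)
      (f' := fun v => (1 + p) * (1 + p * v - (1 + v) ^ p)) ?_ ?_ ?_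
    · refine ContinuousOn.sub (by fun_prop) (ContinuousOn.rpow_const (by fun_prop) ?_)
      exact fun _ _ => Or.inr (by linarith)
    · intro v hv
      rw [interior_Ici] at hv
      have hv1 : 1 + v ≠ 0 := by linarith [Set.mem_Ioi.1 hv]
      have h := (((((hasDerivAt_id v).const_mul (1 + p)).const_add 1).add
        (((hasDerivAt_id v).pow 2).const_mul (p * (1 + p) / 2))).sub
        (((hasDerivAt_id v).const_add 1).rpow_const (p := 1 + p) (Or.inl hv1)))
      refine (h.congr_deriv ?_).hasDerivWithinAt
      simp
      ring
    · intro v hv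
      rw [interior_Ici] at hv
      have h := rpow_one_add_le_one_add_mul_self
        (show -1 ≤ v by linarith [Set.mem_Ioi.1 hv]) hp0.le hp1.le
      exact mul_nonneg (by linarith) (by linarith)
  have h := hmono Set.self_mem_Ici hw hw
  simp at h
  linarith

/-- Local-norm stability estimate for the power function around `1`. -/
lemma linear_sub_rpow_bregman_le {p c t : ℝ} (hp0 : 0 < p) (hp1 : p < 1) (ht : 0 ≤ t)
    (hc : |c| ≤ p * (1 - p) / 4) :
    c * (1 - t) + (t ^ p - 1 - p * (t - 1)) ≤ 2 / (p * (1 - p)) * c ^ 2 := by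
  obtain ⟨w, rfl⟩ : ∃ w, t = 1 + w := ⟨t - 1, by ring⟩
  have hq : 0 < p * (1 - p) := mul_pos hp0 (by linarith)
  obtain ⟨s, rfl⟩ : ∃ s, c = p * (1 - p) / 4 * s :=
    ⟨c / (p * (1 - p) / 4), (mul_div_cancel₀ _ (by positivity)).symm⟩
  have hs : |s| ≤ 1 := by
    rw [abs_mul, abs_of_pos (by positivity)] at hc
    exact le_of_mul_le_mul_left (by linarith) (show 0 < p * (1 - p) / 4 by positivity)
  have hr : 2 / (p * (1 - p)) * (p * (1 - p) / 4 * s) ^ 2 = p * (1 - p) * (s ^ 2 / 8) := by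
    have : 1 - p ≠ 0 := by linarith
    field_simp
    ring
  rw [hr]
  obtain ⟨hs1, hs2⟩ := abs_le.1 hs
  rcases le_total w 0 with hw | hw
  · have h := rpow_one_add_le_quadratic_of_nonpos hp0 hp1 (by linarith) hw
    nlinarith [mul_nonneg hq.le (add_nonneg (sq_nonneg (s + w)) (sq_nonneg w))]
  · have h := rpow_one_add_le_quadratic_of_nonneg hp0 hp1 hw
    rw [Real.rpow_add (by linarith), Real.rpow_one] at h
    refine le_of_mul_le_mul_left ?_ (show 0 < 1 + w by linarith)
    have key : 0 ≤ s ^ 2 * (1 + w) + 4 * w ^ 2 + 2 * s * w * (1 + w) := by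
      nlinarith [sq_nonneg (s + w), mul_nonneg (sq_nonneg w) (show 0 ≤ 1 + s by linarith),
        mul_nonneg (sq_nonneg s) hw]
    nlinarith [mul_nonneg hq.le key]

/-- Single-coordinate stability estimate for the regularizer `-(1 / η) * z ^ p`. -/
lemma rpow_regularizer_stability {p η x y g : ℝ} (hp0 : 0 < p) (hp1 : p < 1) (hη : 0 < η)
    (hx : 0 < x) (hy : 0 ≤ y) (hg : |g| ≤ p * (1 - p) / (4 * η) * x ^ (p - 1)) :
    g * (x - y) + 1 / η * (y ^ p - x ^ p - p * x ^ (p - 1) * (y - x)) ≤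
      2 / (p * (1 - p)) * η * (x ^ (2 - p) * g ^ 2) := by
  obtain ⟨t, rfl⟩ : ∃ t, y = x * t := ⟨y / x, by field_simp⟩
  have ht : 0 ≤ t := nonneg_of_mul_nonneg_right hy hx
  have hX : 0 < x ^ (p - 1) := Real.rpow_pos_of_pos hx _
  obtain ⟨c, rfl⟩ : ∃ c, g = c * (x ^ (p - 1) / η) := ⟨g / (x ^ (p - 1) / η), by field_simp⟩
  have hc : |c| ≤ p * (1 - p) / 4 := by
    rw [abs_mul, abs_of_pos (div_pos hX hη)] at hg
    refine le_of_mul_le_mul_right (hg.trans_eq ?_) (div_pos hX hη)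
    field_simp
  have hxp : x ^ p = x ^ (p - 1) * x := by
    rw [← Real.rpow_add_one hx.ne']; congr 1; ring
  have hx2 : x ^ (2 - p) * x ^ (p - 1) = x := by
    rw [← Real.rpow_add hx]; norm_num
  rw [Real.mul_rpow hx.le ht, hxp]
  have h := mul_le_mul_of_nonneg_left (linear_sub_rpow_bregman_le hp0 hp1 ht hc)
    (show 0 ≤ x ^ (p - 1) * x / η by positivity)
  calc _ = x ^ (p - 1) * x / η * (c * (1 - t) + (t ^ p - 1 - p * (t - 1))) := by ring
    _ ≤ _ := h
    _ = 2 / (p * (1 - p)) * c ^ 2 * (x ^ (p - 1) * (x ^ (2 - p) * x ^ (p - 1)) / η) := by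
      rw [hx2]; ring
    _ = _ := by
      have : 1 - p ≠ 0 := by linarith
      field_simp

theorem stmt_7
    {I : Type*} [Fintype I]
    (α η : ℝ) (hα1 : 1 < α) (hα2 : α ≤ 2) (hη : 0 < η)
    (x ℓ b : I → ℝ) (hx : ∀ i, 0 < x i)
    (hsmall : ∀ i, |ℓ i - b i| ≤ (α - 1) / (4 * α ^ 2 * η) * x i ^ (1/α - 1))
    (Ψ : (I → ℝ) → ℝ)
    (hΨ : ∀ z, Ψ z = -(1/η) * ∑ i, z i ^ (1/α))
    (DΨ : (I → ℝ) → (I → ℝ) → ℝ)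
    (hD : ∀ y w, DΨ y w = Ψ y - Ψ w - ∑ i, (-(1/(α * η)) * w i ^ (1/α - 1)) * (y i - w i)) :
    ∀ y : I → ℝ, (∀ i, 0 ≤ y i) →
      (∑ i, (ℓ i - b i) * (x i - y i)) - DΨ y x ≤
        4 * α ^ 2 / (α - 1) * η * ∑ i, x i ^ (2 - 1/α) * ((ℓ i) ^ 2 + (b i) ^ 2) := by
  intro y hy
  have hα0 : 0 < α := by linarith
  have hα' : 0 < α - 1 := by linarith
  rw [hD, hΨ, hΨ, mul_sum, mul_sum, mul_sum, ← sum_sub_distrib, ← sum_sub_distrib,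
    ← sum_sub_distrib]
  refine sum_le_sum fun i _ => ?_
  have hq : 1 / α * (1 - 1 / α) = (α - 1) / α ^ 2 := by field_simp
  have h := rpow_regularizer_stability (p := 1 / α) (η := η) (g := ℓ i - b i) (by positivity)
    ((div_lt_one hα0).2 hα1) hη (hx i) (hy i) (by
      rw [hq, div_div]
      convert hsmall i using 3
      ring)
  rw [hq] at h
  have hX : 0 < x i ^ (2 - 1 / α) := Real.rpow_pos_of_pos (hx i) _
  calc _ = (ℓ i - b i) * (x i - y i) + 1 / η * (y i ^ (1 / α) - x i ^ (1 / α)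
        - 1 / α * x i ^ (1 / α - 1) * (y i - x i)) := by
        rw [← one_div_mul_one_div]
        ring
    _ ≤ _ := h
    _ = 2 * α ^ 2 / (α - 1) * η * (x i ^ (2 - 1 / α) * (ℓ i - b i) ^ 2) := by
        rw [div_div_eq_mul_div]
    _ ≤ 2 * α ^ 2 / (α - 1) * η * (x i ^ (2 - 1 / α) * (2 * (ℓ i ^ 2 + b i ^ 2))) := by
        gcongr
        nlinarith [sq_nonneg (ℓ i + b i)]
    _ = _ := by ring
end

section
/- Optimal-action positive-part chain: let x = ρ^{ℙ,π} be the occupancy measure of a policy π with x(s,a) > 0 for all (s,a), let ρ̊ = ρ^{ℙ,π̊} be the occupancy measure of a deterministic policy π̊, and let α ∈ (1,2]. Then ∑_{s∈𝒮} (x(s, π̊(s)) − ρ̊(s))_+ · x(s, π̊(s))^{1/α − 1} ≤ ∑_{s∈𝒮} (x(s) − ρ̊(s))_+^{1/α} ≤ H^{1/α} S^{1 − 1/α} · ∑_{(s,a): a ≠ π̊(s)} x(s,a)^{1/α}. -/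
open Finset MeasureTheory

open scoped Classical

/-- Power-mean inequality: `∑ f ^ p ≤ n ^ (1 - p) * (∑ f) ^ p` for `0 < p ≤ 1`. -/
theorem sum_rpow_le_card_rpow_mul_rpow_sum {ι : Type*} (t : Finset ι) (f : ι → ℝ)
    (hf : ∀ i, 0 ≤ f i) {p : ℝ} (hp0 : 0 < p) (hp1 : p ≤ 1) :
    ∑ i ∈ t, f i ^ p ≤ (t.card : ℝ) ^ (1 - p) * (∑ i ∈ t, f i) ^ p := by
  have h := Real.rpow_sum_le_const_mul_sum_rpow_of_nonneg t (f := fun i => f i ^ p) (p := p⁻¹)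
    ((one_le_inv₀ hp0).2 hp1) fun i _ => Real.rpow_nonneg (hf i) p
  have hinv (i : ι) : (f i ^ p) ^ p⁻¹ = f i := Real.rpow_rpow_inv (hf i) hp0.ne'
  simp only [hinv] at h
  have hnn : 0 ≤ ∑ i ∈ t, f i ^ p := sum_nonneg fun i _ => Real.rpow_nonneg (hf i) p
  have h2 := Real.rpow_le_rpow (Real.rpow_nonneg hnn _) h hp0.le
  rwa [Real.rpow_inv_rpow hnn hp0.ne',
    Real.mul_rpow (by positivity) (sum_nonneg fun i _ => hf i),
    ← Real.rpow_mul (by positivity), sub_mul, inv_mul_cancel₀ hp0.ne', one_mul] at h2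

theorem rpow_sum_le_sum_rpow_of_le_one {ι : Type*} (t : Finset ι) (f : ι → ℝ)
    (hf : ∀ i, 0 ≤ f i) {p : ℝ} (hp0 : 0 < p) (hp1 : p ≤ 1) :
    (∑ i ∈ t, f i) ^ p ≤ ∑ i ∈ t, f i ^ p := by
  induction t using Finset.cons_induction with
  | empty => simp [Real.zero_rpow hp0.ne']
  | cons i t hi ih =>
    rw [sum_cons, sum_cons]
    exact (Real.rpow_add_le_add_rpow (hf i) (sum_nonneg fun j _ => hf j) hp0.le hp1).trans
      (by gcongr)

theorem max_sub_mul_rpow_le {y r X p : ℝ} (hr : 0 ≤ r) (hyX : y ≤ X)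
    (hp0 : 0 < p) (hp1 : p ≤ 1) :
    max (y - r) 0 * y ^ (p - 1) ≤ max (X - r) 0 ^ p := by
  rcases le_or_gt (y - r) 0 with h | h
  · rw [max_eq_right h, zero_mul]
    positivity
  · rw [max_eq_left h.le]
    calc (y - r) * y ^ (p - 1) ≤ (y - r) * (y - r) ^ (p - 1) := by
          gcongr ?_ * ?_
          exact Real.rpow_le_rpow_of_nonpos h (by linarith) (by linarith)
      _ = (y - r) ^ p := by
          rw [Real.rpow_sub_one h.ne', mul_div_cancel₀ _ h.ne']
      _ ≤ max (X - r) 0 ^ p := by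
          gcongr
          exact le_max_of_le_left (by linarith)

/-- If the mass `d` vanishes on the first layer and on each later layer is at most the mass
transported by substochastic kernels from the previous layer plus the transported injected mass `y`,
then the total mass is at most `H` times the total injected mass. -/
theorem sum_le_mul_sum_of_layered_transport {S A : Type*} [Fintype S]
    (H : ℕ) (layer : S → ℕ) (hlayer : ∀ s, 1 ≤ layer s ∧ layer s ≤ H)
    (P : S → A → S → ℝ) (hP_nonneg : ∀ s a s', 0 ≤ P s a s')
    (hP_supp : ∀ s a s', P s a s' ≠ 0 → layer s' = layer s + 1)
    (hP_sum : ∀ s a, ∑ s', P s a s' ≤ 1)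
    (a₀ : S → A) (B : S → Finset A) (y : S → A → ℝ) (hy : ∀ s a, 0 ≤ y s a)
    (d : S → ℝ) (hd : ∀ s, 0 ≤ d s) (hd1 : ∀ s, layer s = 1 → d s = 0)
    (hstep : ∀ s', 2 ≤ layer s' →
      d s' ≤ ∑ s, (P s (a₀ s) s' * d s + ∑ a ∈ B s, P s a s' * y s a)) :
    ∑ s, d s ≤ H * ∑ s, ∑ a ∈ B s, y s a := by
  have he (s : S) : 0 ≤ ∑ a ∈ B s, y s a := sum_nonneg fun a _ => hy s a
  have hlevel (h : ℕ) : ∑ s with layer s = h + 1, d s ≤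
      ∑ s with layer s < h + 1, ∑ a ∈ B s, y s a := by
    induction h with
    | zero =>
      rw [sum_eq_zero fun s hs => hd1 s (by simpa using hs)]
      exact sum_nonneg fun s _ => he s
    | succ h ih =>
      calc ∑ s' with layer s' = h + 1 + 1, d s'
          ≤ ∑ s' with layer s' = h + 1 + 1,
              ∑ s, (P s (a₀ s) s' * d s + ∑ a ∈ B s, P s a s' * y s a) := by
            refine sum_le_sum fun s' hs' => hstep s' ?_
            have := (mem_filter.1 hs').2
            omega
        _ = ∑ s' with layer s' = h + 1 + 1, ∑ s with layer s = h + 1,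
              (P s (a₀ s) s' * d s + ∑ a ∈ B s, P s a s' * y s a) := by
            refine sum_congr rfl fun s' hs' => (sum_filter_of_ne fun s _ hne => ?_).symm
            by_contra hs
            have hz (a : A) : P s a s' = 0 := by
              by_contra hP
              have := hP_supp s a s' hP
              have := (mem_filter.1 hs').2
              omega
            simp [hz] at hne
        _ = ∑ s with layer s = h + 1, ∑ s' with layer s' = h + 1 + 1,
              (P s (a₀ s) s' * d s + ∑ a ∈ B s, P s a s' * y s a) := sum_comm
        _ ≤ ∑ s with layer s = h + 1, (d s + ∑ a ∈ B s, y s a) := by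
            refine sum_le_sum fun s _ => ?_
            have hsub (a : A) : ∑ s' with layer s' = h + 1 + 1, P s a s' ≤ 1 :=
              (sum_le_univ_sum_of_nonneg fun s' => hP_nonneg s a s').trans (hP_sum s a)
            rw [sum_add_distrib, ← sum_mul, sum_comm]
            refine add_le_add (mul_le_of_le_one_left (hd s) (hsub _)) (sum_le_sum fun a _ => ?_)
            rw [← sum_mul]
            exact mul_le_of_le_one_left (hy s a) (hsub a)
        _ ≤ ∑ s with layer s < h + 1, ∑ a ∈ B s, y s a +
              ∑ s with layer s = h + 1, ∑ a ∈ B s, y s a := by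
            rw [sum_add_distrib]
            gcongr
        _ = ∑ s with layer s < h + 1 + 1, ∑ a ∈ B s, y s a := by
            simp only [sum_filter, ← sum_add_distrib]
            refine sum_congr rfl fun s _ => ?_
            split_ifs <;> first | omega | simp
  calc ∑ s, d s = ∑ h ∈ range H, ∑ s with layer s = h + 1, d s := by
        rw [← sum_fiberwise_of_maps_to (g := fun s => layer s - 1) (t := range H)
          (fun s _ => by have := hlayer s; simp only [mem_range]; omega)]
        refine sum_congr rfl fun h _ => sum_congr (filter_congr fun s _ => ?_) fun _ _ => rfl
        have := hlayer s
        omega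
    _ ≤ ∑ _h ∈ range H, ∑ s, ∑ a ∈ B s, y s a :=
        sum_le_sum fun h _ => (hlevel h).trans (sum_le_univ_sum_of_nonneg he)
    _ = H * ∑ s, ∑ a ∈ B s, y s a := by simp

theorem stmt_10
    {S A : Type*} [Fintype S] [Fintype A] [Nonempty S] [Nonempty A]
    [DecidableEq S] [DecidableEq A]
    (H : ℕ) (hH : 1 ≤ H)
    (layer : S → ℕ)
    (hlayer : ∀ s : S, 1 ≤ layer s ∧ layer s ≤ H)
    (hlayer_ne : ∀ h : ℕ, 1 ≤ h → h ≤ H → ∃ s : S, layer s = h)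
    (s1 : S) (hs1 : ∀ s : S, (layer s = 1 ↔ s = s1))
    (P : S → A → S → ℝ)
    (hP_nonneg : ∀ s a s', 0 ≤ P s a s')
    (hP_supp : ∀ s a s', P s a s' ≠ 0 → layer s' = layer s + 1)
    (hP_sum : ∀ s a, layer s < H → ∑ s', P s a s' = 1)
    (π : S → A → ℝ)
    (hπ_nonneg : ∀ s a, 0 ≤ π s a)
    (hπ_sum : ∀ s, ∑ a, π s a = 1)
    (x : S → A → ℝ)
    (hx_init : ∀ a, x s1 a = π s1 a)
    (hx_rec : ∀ s' a', 2 ≤ layer s' → x s' a' = π s' a' * ∑ s, ∑ a, P s a s' * x s a)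
    (hx_pos : ∀ s a, 0 < x s a)
    (πd : S → A)
    (ρ : S → A → ℝ)
    (hρ_init : ∀ a, ρ s1 a = if a = πd s1 then (1:ℝ) else 0)
    (hρ_rec : ∀ s' a', 2 ≤ layer s' →
      ρ s' a' = (if a' = πd s' then (1:ℝ) else 0) * ∑ s, ∑ a, P s a s' * ρ s a)
    (α : ℝ) (hα1 : 1 < α) (hα2 : α ≤ 2) :
    (∑ s, max (x s (πd s) - ∑ a, ρ s a) 0 * x s (πd s) ^ (1/α - 1) ≤
      ∑ s, (max ((∑ a, x s a) - ∑ a, ρ s a) 0) ^ (1/α)) ∧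
    (∑ s, (max ((∑ a, x s a) - ∑ a, ρ s a) 0) ^ (1/α) ≤
      (H : ℝ) ^ (1/α) * (Fintype.card S : ℝ) ^ (1 - 1/α) *
        ∑ s, ∑ a ∈ Finset.univ.filter (fun a => a ≠ πd s), x s a ^ (1/α)) := by
  have hp0 : 0 < 1 / α := by positivity
  have hp1 : 1 / α ≤ 1 := by rw [div_le_one (by linarith)]; exact hα1.le
  have hρ_nonneg (h : ℕ) : ∀ s, layer s = h + 1 → ∀ a, 0 ≤ ρ s a := by
    induction h with
    | zero =>
      intro s hs a
      rw [(hs1 s).1 hs, hρ_init]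
      split_ifs <;> norm_num
    | succ h ih =>
      intro s' hs' a'
      rw [hρ_rec s' a' (by omega)]
      refine mul_nonneg (by split_ifs <;> norm_num)
        (sum_nonneg fun s _ => sum_nonneg fun a _ => ?_)
      by_cases hP : P s a s' = 0
      · simp [hP]
      · exact mul_nonneg (hP_nonneg s a s') (ih s (by have := hP_supp s a s' hP; omega) a)
  have hρ0 (s : S) (a : A) : 0 ≤ ρ s a :=
    hρ_nonneg (layer s - 1) s (by have := hlayer s; omega) a
  have hρ_off (s : S) (a : A) (ha : a ≠ πd s) : ρ s a = 0 := by
    rcases eq_or_ne s s1 with rfl | hs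
    · rw [hρ_init, if_neg ha]
    · have h1 : layer s ≠ 1 := fun h => hs ((hs1 s).1 h)
      rw [hρ_rec s a (by have := hlayer s; omega), if_neg ha, zero_mul]
  have hR0 (s : S) : 0 ≤ ∑ a, ρ s a := sum_nonneg fun a _ => hρ0 s a
  have hxX (s : S) : x s (πd s) ≤ ∑ a, x s a :=
    single_le_sum (f := x s) (fun a _ => (hx_pos s a).le) (mem_univ _)
  refine ⟨sum_le_sum fun s _ => max_sub_mul_rpow_le (hR0 s) (hxX s) hp0 hp1, ?_⟩
  have hd0 (s : S) : 0 ≤ max ((∑ a, x s a) - ∑ a, ρ s a) 0 := le_max_right _ _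
  have hP_le (s : S) (a : A) : ∑ s', P s a s' ≤ 1 := by
    rcases (hlayer s).2.lt_or_eq with h | h
    · exact (hP_sum s a h).le
    · rw [sum_eq_zero fun s' _ => ?_]
      · exact zero_le_one
      · by_contra hP
        have := hP_supp s a s' hP
        have := hlayer s'
        omega
  have hsplit (s : S) (f : A → ℝ) :
      ∑ a, f a = f (πd s) + ∑ a ∈ univ.filter (fun a => a ≠ πd s), f a := by
    rw [filter_ne', add_sum_erase _ _ (mem_univ _)]
  have htotal := sum_le_mul_sum_of_layered_transport H layer hlayer P hP_nonneg hP_supp hP_le πd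
    (fun s => univ.filter (fun a => a ≠ πd s)) x (fun s a => (hx_pos s a).le)
    (fun s => max ((∑ a, x s a) - ∑ a, ρ s a) 0) hd0
    (fun s hs => by
      rw [(hs1 s).1 hs]
      simp [hx_init, hρ_init, hπ_sum])
    (fun s' hs' => by
      have hX : ∑ a', x s' a' = ∑ s, ∑ a, P s a s' * x s a := by
        rw [sum_congr rfl fun a' _ => hx_rec s' a' hs', ← sum_mul, hπ_sum, one_mul]
      have hR : ∑ a', ρ s' a' = ∑ s, ∑ a, P s a s' * ρ s a := by
        rw [sum_congr rfl fun a' _ => hρ_rec s' a' hs', ← sum_mul]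
        simp
      refine max_le ?_ (sum_nonneg fun s _ => add_nonneg
        (mul_nonneg (hP_nonneg _ _ _) (hd0 s))
        (sum_nonneg fun a _ => mul_nonneg (hP_nonneg _ _ _) (hx_pos s a).le))
      rw [hX, hR, ← sum_sub_distrib]
      refine sum_le_sum fun s _ => ?_
      have hρs : ∑ a, P s a s' * ρ s a = P s (πd s) s' * ∑ a, ρ s a := by
        rw [mul_sum]
        refine sum_congr rfl fun a _ => ?_
        by_cases ha : a = πd s
        · rw [ha]
        · simp [hρ_off s a ha]
      rw [hρs, hsplit s fun a => P s a s' * x s a, add_sub_right_comm, ← mul_sub]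
      gcongr
      · exact hP_nonneg _ _ _
      · exact le_max_of_le_left (by linarith [hxX s]))
  have hE0 : 0 ≤ ∑ s, ∑ a ∈ univ.filter (fun a => a ≠ πd s), x s a :=
    sum_nonneg fun s _ => sum_nonneg fun a _ => (hx_pos s a).le
  calc ∑ s, (max ((∑ a, x s a) - ∑ a, ρ s a) 0) ^ (1/α)
      ≤ (Fintype.card S : ℝ) ^ (1 - 1/α) *
          (∑ s, max ((∑ a, x s a) - ∑ a, ρ s a) 0) ^ (1/α) :=
        sum_rpow_le_card_rpow_mul_rpow_sum univ _ hd0 hp0 hp1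
    _ ≤ (Fintype.card S : ℝ) ^ (1 - 1/α) *
          (H * ∑ s, ∑ a ∈ univ.filter (fun a => a ≠ πd s), x s a) ^ (1/α) := by
        have := sum_nonneg fun s (_ : s ∈ univ) => hd0 s
        gcongr
    _ = (H : ℝ) ^ (1/α) * (Fintype.card S : ℝ) ^ (1 - 1/α) *
          (∑ s, ∑ a ∈ univ.filter (fun a => a ≠ πd s), x s a) ^ (1/α) := by
        rw [Real.mul_rpow (by positivity) hE0]
        ring
    _ ≤ (H : ℝ) ^ (1/α) * (Fintype.card S : ℝ) ^ (1 - 1/α) *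
          ∑ s, ∑ a ∈ univ.filter (fun a => a ≠ πd s), x s a ^ (1/α) := by
        gcongr
        refine (rpow_sum_le_sum_rpow_of_le_one univ _
          (fun s => sum_nonneg fun a _ => (hx_pos s a).le) hp0 hp1).trans
          (sum_le_sum fun s _ => ?_)
        exact rpow_sum_le_sum_rpow_of_le_one _ (x s) (fun a => (hx_pos s a).le) hp0 hp1
end
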